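/- For all integers k ≥ 1 and ℓ ≥ 2 there exists a k-gap-planar simple graph G with exactly n = 16kℓ − 8k + 1 vertices such that cr_{k-gap}(G) ≥ ℓ and cr(G) ≤ 8k² − 2k (hence the k-gap-planar crossing ratio is Ω(n/k³)). -/

import Mathlib

open Set

noncomputable section

/-- A drawing of a simple graph in the plane: vertices are mapped to distinct
points, each edge `uv` is drawn as a simple arc joining the images of `u` and
`v` and avoiding the images of the other vertices, any two arcs meet in
finitely many points, and no three arcs pass through a common non-vertex
point. -/
structure Drawing {V : Type} (G : SimpleGraph V) where
  vpos : V → ℝ × ℝ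
  vpos_inj : Function.Injective vpos
  arc : V → V → ℝ → ℝ × ℝ
  arc_symm : ∀ u v t, arc u v t = arc v u (1 - t)
  arc_cont : ∀ u v, G.Adj u v → ContinuousOn (arc u v) (Set.Icc 0 1)
  arc_injOn : ∀ u v, G.Adj u v → Set.InjOn (arc u v) (Set.Icc 0 1)
  arc_start : ∀ u v, G.Adj u v → arc u v 0 = vpos u
  arc_end : ∀ u v, G.Adj u v → arc u v 1 = vpos v
  arc_avoids : ∀ u v, G.Adj u v → ∀ t ∈ Set.Ioo (0:ℝ) 1, arc u v t ∉ Set.range vpos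
  inter_finite : ∀ u v w z, G.Adj u v → G.Adj w z → s(u, v) ≠ s(w, z) →
    ((arc u v '' Set.Icc 0 1) ∩ (arc w z '' Set.Icc 0 1)).Finite
  no_triple_point : ∀ p : ℝ × ℝ, p ∉ Set.range vpos →
    ∀ u₁ v₁ u₂ v₂ u₃ v₃, G.Adj u₁ v₁ → G.Adj u₂ v₂ → G.Adj u₃ v₃ →
      s(u₁, v₁) ≠ s(u₂, v₂) → s(u₁, v₁) ≠ s(u₃, v₃) → s(u₂, v₂) ≠ s(u₃, v₃) →
      ¬ (p ∈ arc u₁ v₁ '' Set.Icc 0 1 ∧ p ∈ arc u₂ v₂ '' Set.Icc 0 1 ∧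
          p ∈ arc u₃ v₃ '' Set.Icc 0 1)

namespace Drawing

variable {V : Type} {G : SimpleGraph V}

lemma img_symm_aux (Γ : Drawing G) (u v : V) :
    Γ.arc u v '' Set.Icc 0 1 = Γ.arc v u '' Set.Icc 0 1 := by
  have key : ∀ a b : V, Γ.arc a b '' Set.Icc 0 1 ⊆ Γ.arc b a '' Set.Icc 0 1 := by
    rintro a b p ⟨t, ht, rfl⟩
    refine ⟨1 - t, ⟨by linarith [ht.2], by linarith [ht.1]⟩, ?_⟩
    rw [Γ.arc_symm b a (1 - t)]
    congr 1
    ring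
  exact Set.Subset.antisymm (key u v) (key v u)

/-- The image (trace) of an edge in the drawing. -/
def img (Γ : Drawing G) (e : Sym2 V) : Set (ℝ × ℝ) :=
  Sym2.lift ⟨fun u v => Γ.arc u v '' Set.Icc 0 1, fun u v => Γ.img_symm_aux u v⟩ e

/-- `p` is a crossing point of the two distinct edges `e` and `f` : it lies on
both arcs and is not the image of a vertex (so it is not a shared endpoint). -/
def Crossing (Γ : Drawing G) (e f : Sym2 V) (p : ℝ × ℝ) : Prop :=
  e ∈ G.edgeSet ∧ f ∈ G.edgeSet ∧ e ≠ f ∧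
    p ∈ Γ.img e ∧ p ∈ Γ.img f ∧ p ∉ Set.range Γ.vpos

/-- The edges `e` and `f` cross in the drawing. -/
def Crosses (Γ : Drawing G) (e f : Sym2 V) : Prop := ∃ p, Γ.Crossing e f p

/-- The set of crossing points of a drawing. -/
def crossingSet (Γ : Drawing G) : Set (ℝ × ℝ) := {p | ∃ e f, Γ.Crossing e f p}

/-- The number of crossings of a drawing. -/
def crossings (Γ : Drawing G) : ℕ := Γ.crossingSet.ncard

/-- The set of crossing points lying on a given edge. -/
def edgeCrossings (Γ : Drawing G) (e : Sym2 V) : Set (ℝ × ℝ) :=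
  {p | ∃ f, Γ.Crossing e f p}

/-- A drawing is `k`-planar if every edge is involved in at most `k` crossings. -/
def IsKPlanar (Γ : Drawing G) (k : ℕ) : Prop :=
  ∀ e ∈ G.edgeSet, (Γ.edgeCrossings e).ncard ≤ k

/-- A drawing is `k`-gap-planar if each crossing can be assigned to one of its
two involved edges such that every edge is assigned at most `k` crossings. -/
def IsKGapPlanar (Γ : Drawing G) (k : ℕ) : Prop :=
  ∃ assign : ℝ × ℝ → Sym2 V,
    (∀ p ∈ Γ.crossingSet, ∃ f, Γ.Crossing (assign p) f p) ∧
    ∀ e : Sym2 V, {p | p ∈ Γ.crossingSet ∧ assign p = e}.ncard ≤ k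

/-- A drawing is skewness-`k` if there is a set of at most `k` edges such that
every crossing involves an edge from the set. -/
def IsSkewness (Γ : Drawing G) (k : ℕ) : Prop :=
  ∃ S : Finset (Sym2 V), S.card ≤ k ∧
    ∀ p ∈ Γ.crossingSet, ∃ e ∈ S, ∃ f, Γ.Crossing e f p

/-- A drawing is `k`-apex if there is a set of at most `k` vertices such that
every crossing involves an edge incident to one of these vertices. -/
def IsKApex (Γ : Drawing G) (k : ℕ) : Prop :=
  ∃ S : Finset V, S.card ≤ k ∧
    ∀ p ∈ Γ.crossingSet, ∃ e f, Γ.Crossing e f p ∧ ∃ a ∈ S, a ∈ e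

/-- A drawing is `(k,l)`-grid-free if there is no set of `k` edges each of
which crosses each edge of some set of `l` edges. -/
def IsGridFree (Γ : Drawing G) (k l : ℕ) : Prop :=
  ¬ ∃ A B : Finset (Sym2 V), A.card = k ∧ B.card = l ∧
      ∀ e ∈ A, ∀ f ∈ B, Γ.Crosses e f

/-- A drawing is `k`-fan-crossing-free if no edge crosses `k` edges that all
share a common endpoint. -/
def IsKFanCrossingFree (Γ : Drawing G) (k : ℕ) : Prop :=
  ¬ ∃ (e : Sym2 V) (a : V) (F : Finset (Sym2 V)), F.card = k ∧
      ∀ f ∈ F, a ∈ f ∧ Γ.Crosses e f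

/-- A drawing is planarly connected if for any two crossing edges, two of
their endpoints are joined by a crossing-free edge. -/
def IsPlanarlyConnected (Γ : Drawing G) : Prop :=
  ∀ e f : Sym2 V, Γ.Crosses e f →
    ∃ a b : V, a ∈ e ∧ b ∈ f ∧ G.Adj a b ∧ Γ.edgeCrossings s(a, b) = ∅

/-- A drawing is straight-line if every edge is drawn as the line segment
between the images of its endpoints. -/
def IsStraight (Γ : Drawing G) : Prop :=
  ∀ u v : V, G.Adj u v → ∀ t ∈ Set.Icc (0:ℝ) 1,
    Γ.arc u v t = (1 - t) • Γ.vpos u + t • Γ.vpos v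

/-- A straight-line RAC drawing: straight-line and any two crossing edges are
perpendicular. -/
def IsRAC (Γ : Drawing G) : Prop :=
  Γ.IsStraight ∧
    ∀ u v w z : V, G.Adj u v → G.Adj w z → Γ.Crosses s(u, v) s(w, z) →
      (Γ.vpos v - Γ.vpos u).1 * (Γ.vpos z - Γ.vpos w).1 +
        (Γ.vpos v - Γ.vpos u).2 * (Γ.vpos z - Γ.vpos w).2 = 0

end Drawing

/-- The crossing number of `G`: the minimum number of crossings over all
drawings of `G`. -/
def crNum {V : Type} (G : SimpleGraph V) : ℕ :=
  sInf {n | ∃ Γ : Drawing G, Γ.crossings = n}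

/-- The crossing number of `G` restricted to drawings satisfying `P`. -/
def crNumRestricted {V : Type} (G : SimpleGraph V) (P : Drawing G → Prop) : ℕ :=
  sInf {n | ∃ Γ : Drawing G, P Γ ∧ Γ.crossings = n}

/-- The rectilinear crossing number of `G`. -/
def rectCrNum {V : Type} (G : SimpleGraph V) : ℕ :=
  crNumRestricted G (fun Γ => Γ.IsStraight)

/-- An ℓ₂-bundle between `x` and `y`: `P` is the set of the internal vertices
of ℓ internally disjoint paths of length two from `x` to `y`, all of whose
internal vertices have degree exactly two in `G` (here ℓ = `P.card`). -/
def IsL2Bundle {V : Type} (G : SimpleGraph V) (x y : V) (P : Finset V) : Prop :=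
  x ≠ y ∧ x ∉ P ∧ y ∉ P ∧
    ∀ p ∈ P, G.Adj x p ∧ G.Adj p y ∧ (G.neighborSet p).ncard = 2

/-- Two drawings of `G` are weakly isomorphic: there is an incidence-preserving
one-to-one correspondence of vertices and edges that preserves crossings. -/
def WeaklyIso {V : Type} {G : SimpleGraph V} (Γ Γ' : Drawing G) : Prop :=
  ∃ φ : G ≃g G, ∀ e f : Sym2 V,
    Γ.Crosses e f ↔ Γ'.Crosses (Sym2.map (fun a => φ a) e) (Sym2.map (fun a => φ a) f)

theorem exists_continuous_log {X : Type} [TopologicalSpace X] [SimplyConnectedSpace X]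
    [LocallyPathConnectedSpace X] {g : X → ℂ} (hg : Continuous g) (h0 : ∀ x, g x ≠ 0) :
    ∃ f : X → ℂ, Continuous f ∧ ∀ x, Complex.exp (f x) = g x := by
  obtain ⟨a₀⟩ : Nonempty X := inferInstance
  obtain ⟨F, ⟨-, hF⟩, -⟩ := Complex.isCoveringMapOn_exp.existsUnique_continuousMap_lifts
    ⟨g, hg⟩ (Complex.exp_log (h0 a₀)) (fun a => h0 a)
  exact ⟨F, F.continuous, fun x => congrFun hF x⟩

theorem continuous_log_sub_eq {f₁ f₂ : ℝ → ℂ} (h₁ : Continuous f₁) (h₂ : Continuous f₂)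
    (h : ∀ t, Complex.exp (f₁ t) = Complex.exp (f₂ t)) (s t : ℝ) :
    f₁ t - f₁ s = f₂ t - f₂ s := by
  have hc : Complex.exp (f₂ s - f₁ s) = 1 := by
    rw [Complex.exp_sub, h s, div_self (Complex.exp_ne_zero _)]
  obtain ⟨F, -, hF⟩ := Complex.isCoveringMapOn_exp.existsUnique_continuousMap_lifts
    (⟨fun t => Complex.exp (f₂ t), by fun_prop⟩ : C(ℝ, ℂ)) (a₀ := s) (e₀ := f₂ s) rfl
    (fun a => Complex.exp_ne_zero _)
  have e₁ := hF ⟨fun t => f₁ t + (f₂ s - f₁ s), by fun_prop⟩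
    ⟨by simp, by ext t; simp [Complex.exp_add, hc, h t]⟩
  have e₂ := hF ⟨f₂, h₂⟩ ⟨rfl, rfl⟩
  have := congrArg (fun G : C(ℝ, ℂ) => G t) (e₁.trans e₂.symm)
  simp only [ContinuousMap.coe_mk] at this
  rw [← this]; ring

open Classical in
/-- The change along `[0, 1]` of a continuous logarithm of `γ - z`. -/
def logVar (γ : ℝ → ℂ) (z : ℂ) : ℂ :=
  if h : ∃ f : ℝ → ℂ, Continuous f ∧ ∀ t, Complex.exp (f t) = γ t - z then
    h.choose 1 - h.choose 0 else 0

theorem logVar_eq {γ : ℝ → ℂ} {z : ℂ} {f : ℝ → ℂ} (hf : Continuous f)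
    (h : ∀ t, Complex.exp (f t) = γ t - z) : logVar γ z = f 1 - f 0 := by
  have hex : ∃ f : ℝ → ℂ, Continuous f ∧ ∀ t, Complex.exp (f t) = γ t - z := ⟨f, hf, h⟩
  rw [logVar, dif_pos hex]
  exact continuous_log_sub_eq hex.choose_spec.1 hf
    (fun t => (hex.choose_spec.2 t).trans (h t).symm) 0 1

theorem exp_logVar {γ : ℝ → ℂ} (hγ : Continuous γ) {z : ℂ} (hz : ∀ t, γ t ≠ z) :
    Complex.exp (logVar γ z) * (γ 0 - z) = γ 1 - z := by
  obtain ⟨f, hf, h⟩ := exists_continuous_log (g := fun t => γ t - z) (by fun_prop)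
    (fun t => sub_ne_zero.2 (hz t))
  rw [logVar_eq hf h, ← h 0, ← h 1, Complex.exp_sub, div_mul_cancel₀ _ (Complex.exp_ne_zero _)]

theorem logVar_add_logVar {γ δ : ℝ → ℂ} (hγ : Continuous γ) (hδ : Continuous δ)
    (hd : ∀ s t, γ s ≠ δ t) :
    logVar γ (δ 0) + logVar δ (γ 1) = logVar γ (δ 1) + logVar δ (γ 0) := by
  have : SimplyConnectedSpace (ℝ × ℝ) := inferInstance
  obtain ⟨f, hf, h⟩ := exists_continuous_log (X := ℝ × ℝ) (g := fun p => γ p.1 - δ p.2)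
    (by fun_prop) (fun p => sub_ne_zero.2 (hd _ _))
  have h1 : ∀ t, logVar γ (δ t) = f (1, t) - f (0, t) := fun t =>
    logVar_eq (f := fun s => f (s, t)) (by fun_prop) (fun s => h (s, t))
  have h2 : ∀ s, logVar δ (γ s) = f (s, 1) - f (s, 0) := fun s => by
    rw [logVar_eq (f := fun t => f (s, t) + Real.pi * Complex.I) (by fun_prop)]
    · ring
    · intro t
      rw [Complex.exp_add, h, Complex.exp_pi_mul_I]; ring
  rw [h1, h1, h2, h2]; ring

/-- The complete bipartite graph `K₃,₃`, with parts the even and the odd elements of `Fin 6`,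
has no drawing in which any two independent edges are disjoint. -/
theorem not_K33_joinedIn (x : Fin 6 → ℂ) (hx : Function.Injective x) (F : Fin 6 → Fin 6 → Set ℂ)
    (hj : ∀ u w : Fin 6, u < w → (u.val + w.val) % 2 = 1 → JoinedIn (F u w) (x u) (x w))
    (hd : ∀ u w u' w' : Fin 6, u < w → (u.val + w.val) % 2 = 1 → u' < w' →
      (u'.val + w'.val) % 2 = 1 → u ≠ u' → u ≠ w' → w ≠ u' → w ≠ w' →
      Disjoint (F u w) (F u' w')) : False := by
  have key : ∀ u w : Fin 6, ∃ γ : ℝ → ℂ, u < w → (u.val + w.val) % 2 = 1 →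
      Continuous γ ∧ γ 0 = x u ∧ γ 1 = x w ∧ ∀ t, γ t ∈ F u w := by
    intro u w
    by_cases h : u < w ∧ (u.val + w.val) % 2 = 1
    · refine ⟨(hj u w h.1 h.2).somePath.extend, fun _ _ => ⟨Path.continuous_extend _,
        Path.extend_zero _, Path.extend_one _, fun t => ?_⟩⟩
      exact (hj u w h.1 h.2).somePath_mem _
    · exact ⟨0, fun h1 h2 => absurd ⟨h1, h2⟩ h⟩
  choose γ hγ using key
  let θ : Fin 6 → Fin 6 → ℂ := fun u v =>
    if u < v then Complex.log (x u - x v) else Complex.log (x v - x u) + Real.pi * Complex.I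
  have hθ : ∀ u v, u ≠ v → Complex.exp (θ u v) = x u - x v := by
    intro u v huv
    by_cases h : u < v
    · simp only [θ, if_pos h]
      rw [Complex.exp_log (sub_ne_zero.2 (hx.ne huv))]
    · simp only [θ, if_neg h]
      rw [Complex.exp_add, Complex.exp_log (sub_ne_zero.2 (hx.ne huv.symm)),
        Complex.exp_pi_mul_I]
      ring
  have hθs : ∀ u v, u < v → θ v u = θ u v + Real.pi * Complex.I := by
    intro u v h
    simp [θ, h, not_lt.2 h.le]
  have avoid : ∀ u w v : Fin 6, u < w → (u.val + w.val) % 2 = 1 → v ≠ u → v ≠ w →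
      ∀ t, γ u w t ≠ x v := by
    intro u w v h1 h2 h3 h4 t ht
    have hind : ∀ u w v : Fin 6, u < w → (u.val + w.val) % 2 = 1 → v ≠ u → v ≠ w →
        ∃ u' w' : Fin 6, u' < w' ∧ (u'.val + w'.val) % 2 = 1 ∧ u ≠ u' ∧ u ≠ w' ∧ w ≠ u' ∧
          w ≠ w' ∧ (v = u' ∨ v = w') := by decide
    obtain ⟨u', w', a1, a2, a3, a4, a5, a6, a7⟩ := hind u w v h1 h2 h3 h4
    have hm := (hγ u w h1 h2).2.2.2 t
    have hD := Set.disjoint_left.1 (hd u w u' w' h1 h2 a1 a2 a3 a4 a5 a6) hm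
    apply hD
    rw [ht]
    rcases a7 with rfl | rfl
    · exact (hj _ _ a1 a2).mem.1
    · exact (hj _ _ a1 a2).mem.2
  have key2 : ∀ u w v : Fin 6, ∃ n : ℤ, u < w → (u.val + w.val) % 2 = 1 → v ≠ u → v ≠ w →
      logVar (γ u w) (x v) = θ w v - θ u v + n * (2 * Real.pi * Complex.I) := by
    intro u w v
    by_cases h : (u < w ∧ (u.val + w.val) % 2 = 1) ∧ v ≠ u ∧ v ≠ w
    · obtain ⟨⟨h1, h2⟩, h3, h4⟩ := h
      obtain ⟨c1, c2, c3, -⟩ := hγ u w h1 h2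
      have e := exp_logVar c1 (avoid u w v h1 h2 h3 h4)
      rw [c2, c3, ← hθ u v h3.symm, ← hθ w v h4.symm, ← Complex.exp_add,
        Complex.exp_eq_exp_iff_exists_int] at e
      obtain ⟨n, hn⟩ := e
      exact ⟨n, fun _ _ _ _ => by linear_combination hn⟩
    · exact ⟨0, fun h1 h2 h3 h4 => absurd ⟨⟨h1, h2⟩, h3, h4⟩ h⟩
  choose n hn using key2
  let s : Fin 6 → Fin 6 → ℤ := fun u v => if u < v then 0 else 1
  have hs : ∀ u v, u ≠ v → θ u v - θ v u = (2 * s u v - 1 : ℤ) * (Real.pi * Complex.I) := by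
    intro u v huv
    rcases lt_or_gt_of_ne huv with h | h
    · rw [hθs u v h]; simp [s, h]
    · rw [hθs v u h]; simp [s, not_lt.2 h.le]
  have rel : ∀ u w u' w' : Fin 6, u < w → (u.val + w.val) % 2 = 1 → u' < w' →
      (u'.val + w'.val) % 2 = 1 → u ≠ u' → u ≠ w' → w ≠ u' → w ≠ w' →
      n u w u' - n u w w' + n u' w' w - n u' w' u + s w u' - s u u' - s w w' + s u w' = 0 := by
    intro u w u' w' h1 h2 h3 h4 a1 a2 a3 a4
    obtain ⟨c1, c2, c3, c4⟩ := hγ u w h1 h2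
    obtain ⟨d1, d2, d3, d4⟩ := hγ u' w' h3 h4
    have e := logVar_add_logVar c1 d1 (fun p q hpq =>
      Set.disjoint_left.1 (hd u w u' w' h1 h2 h3 h4 a1 a2 a3 a4) (c4 p) (hpq ▸ d4 q))
    rw [c2, c3, d2, d3, hn u w u' h1 h2 a1.symm a3.symm, hn u w w' h1 h2 a2.symm a4.symm,
      hn u' w' u h3 h4 a1 a2, hn u' w' w h3 h4 a3 a4] at e
    have q1 := hs w u' a3
    have q2 := hs u u' a1
    have q3 := hs w w' a4
    have q4 := hs u w' a2
    have hpi : (2 * Real.pi * Complex.I : ℂ) ≠ 0 := by simp [Real.pi_ne_zero]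
    have : ((n u w u' - n u w w' + n u' w' w - n u' w' u + s w u' - s u u' - s w w' + s u w' : ℤ)
        : ℂ) * (2 * Real.pi * Complex.I) = 0 := by
      push_cast at q1 q2 q3 q4 ⊢
      linear_combination e - q1 + q2 + q3 - q4
    exact_mod_cast (mul_eq_zero.1 this).resolve_right hpi
  have r0 := rel 0 1 2 3 (by decide) (by decide) (by decide) (by decide) (by decide) (by decide) (by decide) (by decide)
  have r1 := rel 0 1 2 5 (by decide) (by decide) (by decide) (by decide) (by decide) (by decide) (by decide) (by decide)
  have r2 := rel 0 1 3 4 (by decide) (by decide) (by decide) (by decide) (by decide) (by decide) (by decide) (by decide)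
  have r3 := rel 0 1 4 5 (by decide) (by decide) (by decide) (by decide) (by decide) (by decide) (by decide) (by decide)
  have r4 := rel 0 3 1 2 (by decide) (by decide) (by decide) (by decide) (by decide) (by decide) (by decide) (by decide)
  have r5 := rel 0 3 1 4 (by decide) (by decide) (by decide) (by decide) (by decide) (by decide) (by decide) (by decide)
  have r6 := rel 0 3 2 5 (by decide) (by decide) (by decide) (by decide) (by decide) (by decide) (by decide) (by decide)
  have r7 := rel 0 3 4 5 (by decide) (by decide) (by decide) (by decide) (by decide) (by decide) (by decide) (by decide)
  have r8 := rel 0 5 1 2 (by decide) (by decide) (by decide) (by decide) (by decide) (by decide) (by decide) (by decide)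
  have r9 := rel 0 5 1 4 (by decide) (by decide) (by decide) (by decide) (by decide) (by decide) (by decide) (by decide)
  have r10 := rel 0 5 2 3 (by decide) (by decide) (by decide) (by decide) (by decide) (by decide) (by decide) (by decide)
  have r11 := rel 0 5 3 4 (by decide) (by decide) (by decide) (by decide) (by decide) (by decide) (by decide) (by decide)
  have r12 := rel 1 2 3 4 (by decide) (by decide) (by decide) (by decide) (by decide) (by decide) (by decide) (by decide)
  have r13 := rel 1 2 4 5 (by decide) (by decide) (by decide) (by decide) (by decide) (by decide) (by decide) (by decide)
  have r14 := rel 1 4 2 3 (by decide) (by decide) (by decide) (by decide) (by decide) (by decide) (by decide) (by decide)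
  have r15 := rel 1 4 2 5 (by decide) (by decide) (by decide) (by decide) (by decide) (by decide) (by decide) (by decide)
  have r16 := rel 2 3 4 5 (by decide) (by decide) (by decide) (by decide) (by decide) (by decide) (by decide) (by decide)
  have r17 := rel 2 5 3 4 (by decide) (by decide) (by decide) (by decide) (by decide) (by decide) (by decide) (by decide)
  simp only [s, Fin.isValue, Fin.reduceLT, if_true, if_false] at r0 r1 r2 r3 r4 r5 r6 r7 r8 r9 r10 r11 r12 r13 r14 r15 r16 r17
  omega

/-- The vertices of the graph: `inl (i, 0)` is the `i`-th node of a cycle of length `2 * m + 2`,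
and the others are the midpoints of paths of length two. -/
abbrev Vtx (m L s : ℕ) : Type := (Fin (2 * m + 2) × Fin (L + 1)) ⊕ Fin s

/-- The paths making up the graph: `L + 1` paths for each edge of the cycle, `s` paths joining the
nodes `0` and `m + 1`, and `m` single edges. -/
inductive Strand (m L s : ℕ) : Type
  | rim (i : Fin (2 * m + 2)) (j : Fin (L + 1))
  | long (t : Fin s)
  | chord (a : Fin m)

namespace Strand

variable {m L s : ℕ}

/-- The end of a strand with the smaller index. -/
def lo : Strand m L s → Fin (2 * m + 2)
  | rim i _ => if i.val = 2 * m + 1 then 0 else i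
  | long _ => 0
  | chord a => ⟨a + 1, by omega⟩

/-- The end of a strand with the larger index. -/
def hi : Strand m L s → Fin (2 * m + 2)
  | rim i _ => ⟨min (i + 1) (2 * m + 1), by omega⟩
  | long _ => ⟨m + 1, by omega⟩
  | chord a => ⟨a + m + 2, by omega⟩

/-- The `i`-th vertex of the cycle. -/
def node (i : Fin (2 * m + 2)) : Vtx m L s := Sum.inl (i, 0)

/-- The middle vertex of a strand; it is one of the ends if the strand is a single edge. -/
def mid : Strand m L s → Vtx m L s
  | rim i j => Sum.inl (i, j)
  | long t => Sum.inr t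
  | chord a => node ⟨a + 1, by omega⟩

/-- The edges of a strand, possibly together with a loop. -/
def edges (c : Strand m L s) : Set (Sym2 (Vtx m L s)) :=
  {s(node c.lo, c.mid), s(c.mid, node c.hi)}

/-- The strand of which a vertex is the middle. -/
def ofVtx : Vtx m L s → Strand m L s
  | Sum.inl (i, j) => rim i j
  | Sum.inr t => long t

/-- The abscissa of a vertex. -/
def posX : Vtx m L s → ℝ
  | Sum.inl (i, j) =>
    if j = 0 then (i : ℝ) else (((rim i j : Strand m L s).lo : ℝ) + (rim i j : Strand m L s).hi) / 2
  | Sum.inr _ => ((m : ℝ) + 1) / 2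

/-- The coefficient of the parabola on which a strand is drawn. The last chord is drawn below the
cycle if `flip` holds. -/
def coef (flip : Bool) : Strand m L s → ℝ
  | rim i j => if i.val = 2 * m + 1 then 2 + (j : ℝ) else -((j : ℝ) / (L + 1))
  | long t => -((t : ℝ) + 1)
  | chord a => if flip = true ∧ a.val + 1 = m then -1 else 1

/-- The parabola on which a strand is drawn. -/
def curve (flip : Bool) (c : Strand m L s) (x : ℝ) : ℝ :=
  c.coef flip * ((x - c.lo) * (c.hi - x))

/-- The ordinate of a vertex. -/
def posY (flip : Bool) (v : Vtx m L s) : ℝ := (ofVtx v).curve flip (posX v)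

theorem node_injective : Function.Injective (node : Fin (2 * m + 2) → Vtx m L s) := by
  intro i j h
  simpa [node] using h

theorem lo_rim (i : Fin (2 * m + 2)) (j : Fin (L + 1)) :
    (((rim i j : Strand m L s).lo : Fin _) : ℕ) = if i.val = 2 * m + 1 then 0 else i.val := by
  simp only [lo]; split_ifs <;> simp

theorem lo_lt_hi (c : Strand m L s) : c.lo.val < c.hi.val := by
  rcases c with ⟨i, j⟩ | t | a
  · rw [lo_rim]; simp only [hi]; split_ifs <;> omega
  · simp [lo, hi]
  · simp only [lo, hi]; omega

theorem lo_lt_hi' (c : Strand m L s) : (c.lo : ℝ) < c.hi := by exact_mod_cast c.lo_lt_hi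

@[simp] theorem posX_node (i : Fin (2 * m + 2)) : posX (node i : Vtx m L s) = i := by
  simp [posX, node]

@[simp] theorem posY_node (flip : Bool) (i : Fin (2 * m + 2)) :
    posY flip (node i : Vtx m L s) = 0 := by
  rw [posY, posX_node, node, ofVtx, curve]
  by_cases h : i.val = 2 * m + 1
  · simp [hi, h]
  · simp [lo, h]

theorem curve_lo (flip : Bool) (c : Strand m L s) : c.curve flip c.lo = 0 := by simp [curve]

theorem curve_hi (flip : Bool) (c : Strand m L s) : c.curve flip c.hi = 0 := by simp [curve]

theorem ofVtx_mid (c : Strand m L s) :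
    c.mid = node c.lo ∨ c.mid = node c.hi ∨
      (posX c.mid = ((c.lo : ℝ) + c.hi) / 2 ∧ ofVtx c.mid = c ∧ ∀ flip, c.coef flip ≠ 0) := by
  rcases c with ⟨i, j⟩ | t | a
  · by_cases hj : j = 0
    · subst hj
      by_cases h : i.val = 2 * m + 1
      · right; left
        simp only [mid, node, hi, Sum.inl.injEq, Prod.mk.injEq, and_true]
        ext; simp [h]
      · left
        simp [mid, node, lo, h]
    · right; right
      refine ⟨by simp [mid, posX, hj], rfl, fun _ => ?_⟩
      simp only [coef]
      split_ifs
      · positivity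
      · have : (j.val : ℝ) ≠ 0 := Nat.cast_ne_zero.2 fun h => hj (Fin.ext h)
        have hL : (L : ℝ) + 1 ≠ 0 := by positivity
        exact neg_ne_zero.2 (div_ne_zero this hL)
  · right; right
    refine ⟨by simp [mid, posX, lo, hi], rfl, fun _ => ?_⟩
    exact neg_ne_zero.2 (by positivity : (t : ℝ) + 1 ≠ 0)
  · left; rfl

theorem posX_mid_mem (c : Strand m L s) : (c.lo : ℝ) ≤ posX c.mid ∧ posX c.mid ≤ c.hi := by
  have := c.lo_lt_hi'
  rcases c.ofVtx_mid with h | h | ⟨h, -, -⟩ <;> simp only [h, posX_node] <;>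
    constructor <;> linarith

theorem posY_mid (flip : Bool) (c : Strand m L s) :
    posY flip c.mid = c.curve flip (posX c.mid) := by
  rcases c.ofVtx_mid with h | h | ⟨-, h, -⟩
  · rw [h]; simp [curve_lo]
  · rw [h]; simp [curve_hi]
  · rw [posY, h]

theorem eq_node_lo {c : Strand m L s} (h : posX c.mid = c.lo) : c.mid = node c.lo := by
  have := c.lo_lt_hi'
  rcases c.ofVtx_mid with h' | h' | ⟨h', -, -⟩
  · exact h'
  · rw [h', posX_node] at h; linarith
  · linarith

theorem eq_node_hi {c : Strand m L s} (h : posX c.mid = c.hi) : c.mid = node c.hi := by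
  have := c.lo_lt_hi'
  rcases c.ofVtx_mid with h' | h' | ⟨h', -, -⟩
  · rw [h', posX_node] at h; linarith
  · exact h'
  · linarith

theorem parabola_ne_of_abs_lt {κ κ' p q p' q' x : ℝ} (hκ : |κ| < |κ'|) (h1 : p' ≤ p) (h2 : q ≤ q')
    (hp : p < x) (hq : x < q) : κ * ((x - p) * (q - x)) ≠ κ' * ((x - p') * (q' - x)) := by
  intro h
  have h3 : 0 < (x - p) * (q - x) := mul_pos (by linarith) (by linarith)
  have h4 : (x - p) * (q - x) ≤ (x - p') * (q' - x) :=
    mul_le_mul (by linarith) (by linarith) (by linarith) (by linarith)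
  have h5 := congrArg abs h
  rw [abs_mul κ, abs_mul κ', abs_of_pos h3, abs_of_pos (h3.trans_le h4)] at h5
  have h6 : |κ| * ((x - p) * (q - x)) < |κ'| * ((x - p) * (q - x)) :=
    mul_lt_mul_of_pos_right hκ h3
  have h7 : |κ'| * ((x - p) * (q - x)) ≤ |κ'| * ((x - p') * (q' - x)) :=
    mul_le_mul_of_nonneg_left h4 (abs_nonneg _)
  linarith

theorem parabola_ne_of_sign {κ κ' p q p' q' x : ℝ} (hκ : κ ≤ 0) (hκ' : 0 < κ')
    (hp : p < x) (hq : x < q) (hp' : p' < x) (hq' : x < q') :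
    κ * ((x - p) * (q - x)) ≠ κ' * ((x - p') * (q' - x)) := by
  have h3 : 0 < (x - p) * (q - x) := mul_pos (by linarith) (by linarith)
  have h4 : 0 < (x - p') * (q' - x) := mul_pos (by linarith) (by linarith)
  have := mul_pos hκ' h4
  have := mul_nonpos_of_nonpos_of_nonneg hκ h3.le
  linarith

/-- The abscissa `x` is in the interior of the range of the strand. -/
def Inside (c : Strand m L s) (x : ℝ) : Prop := (c.lo : ℝ) < x ∧ x < c.hi

/-- The two kinds of pairs of strands that cross. -/
def Exc (flip : Bool) (c c' : Strand m L s) (x : ℝ) : Prop :=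
  (∃ a b, c = chord a ∧ c' = chord b ∧ a ≠ b ∧
    (flip = true ∧ a.val + 1 = m ↔ flip = true ∧ b.val + 1 = m) ∧ 2 * x = a + b + m + 3) ∨
  ∃ a t, c = chord a ∧ c' = long t ∧ flip = true ∧ a.val + 1 = m

theorem rim_inside {i : Fin (2 * m + 2)} {j : Fin (L + 1)} {x : ℝ}
    (h : (rim i j : Strand m L s).Inside x) :
    (i.val = 2 * m + 1 ∧ 0 < x ∧ x < 2 * m + 1 ∧ ((rim i j : Strand m L s).lo : ℝ) = 0 ∧
      ((rim i j : Strand m L s).hi : ℝ) = 2 * m + 1 ∧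
      ∀ flip, (rim i j : Strand m L s).coef flip = 2 + j) ∨
    (i.val < 2 * m + 1 ∧ i < x ∧ x < i + 1 ∧ ((rim i j : Strand m L s).lo : ℝ) = i ∧
      ((rim i j : Strand m L s).hi : ℝ) = i + 1 ∧
      ∀ flip, (rim i j : Strand m L s).coef flip = -((j : ℝ) / (L + 1))) := by
  obtain ⟨h1, h2⟩ := h
  by_cases hi' : i.val = 2 * m + 1
  · left
    have e1 : ((rim i j : Strand m L s).lo : ℝ) = 0 := by simp [lo, hi']
    have e2 : ((rim i j : Strand m L s).hi : ℝ) = 2 * m + 1 := by simp [hi, hi']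
    rw [e1] at h1; rw [e2] at h2
    exact ⟨hi', h1, h2, e1, e2, fun _ => by simp [coef, hi']⟩
  · right
    have e0 : min (i.val + 1) (2 * m + 1) = i.val + 1 := by omega
    have e1 : ((rim i j : Strand m L s).lo : ℝ) = i := by simp [lo, hi']
    have e2 : ((rim i j : Strand m L s).hi : ℝ) = i + 1 := by simp only [hi, e0]; push_cast; ring
    rw [e1] at h1; rw [e2] at h2
    exact ⟨by omega, h1, h2, e1, e2, fun _ => by simp [coef, hi']⟩

theorem nested_of_inside {i p q : ℕ} {x : ℝ} (h1 : (i : ℝ) < x) (h2 : x < i + 1)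
    (h3 : (p : ℝ) < x) (h4 : x < q) : (p : ℝ) ≤ i ∧ (i : ℝ) + 1 ≤ q := by
  have a : (p : ℝ) < (i + 1 : ℕ) := by push_cast; linarith
  have b : (i : ℝ) < q := by linarith
  have a' : p < i + 1 := by exact_mod_cast a
  have b' : i < q := by exact_mod_cast b
  exact ⟨by exact_mod_cast (by omega : p ≤ i), by exact_mod_cast (by omega : i + 1 ≤ q)⟩

theorem abs_short_lt_one (j : Fin (L + 1)) : |(-((j : ℝ) / (L + 1)))| < 1 := by
  have : (j : ℝ) < L + 1 := by exact_mod_cast j.2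
  rw [abs_neg, abs_of_nonneg (by positivity), div_lt_one (by positivity)]
  exact this

theorem rim_ne_chord {flip : Bool} {i : Fin (2 * m + 2)} {j : Fin (L + 1)} {a : Fin m} {x : ℝ}
    (h : (rim i j : Strand m L s).Inside x) (h' : (chord a : Strand m L s).Inside x) :
    (rim i j : Strand m L s).curve flip x ≠ (chord a : Strand m L s).curve flip x := by
  have hc : |(chord a : Strand m L s).coef flip| = 1 := by
    simp only [coef]; split_ifs <;> simp
  rcases rim_inside h with ⟨-, h1, h2, e1, e2, e3⟩ | ⟨-, h1, h2, e1, e2, e3⟩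
  · refine (parabola_ne_of_abs_lt ?_ ?_ ?_ h'.1 h'.2).symm
    · rw [hc, e3, abs_of_nonneg (by positivity)]
      have : (0 : ℝ) ≤ j := by positivity
      linarith
    · rw [e1]; positivity
    · rw [e2]; simp only [hi]
      have : (a : ℝ) + 1 ≤ m := by exact_mod_cast a.2
      push_cast; linarith
  · obtain ⟨n1, n2⟩ := nested_of_inside h1 h2 h'.1 h'.2
    refine parabola_ne_of_abs_lt ?_ ?_ ?_ h.1 h.2
    · rw [hc, e3]; exact abs_short_lt_one j
    · rw [e1]; exact n1
    · rw [e2]; exact n2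

theorem rim_ne_long {flip : Bool} {i : Fin (2 * m + 2)} {j : Fin (L + 1)} {t : Fin s} {x : ℝ}
    (h : (rim i j : Strand m L s).Inside x) (h' : (long t : Strand m L s).Inside x) :
    (rim i j : Strand m L s).curve flip x ≠ (long t : Strand m L s).curve flip x := by
  have ht : (0 : ℝ) ≤ t := by positivity
  rcases rim_inside h with ⟨-, h1, h2, e1, e2, e3⟩ | ⟨-, h1, h2, e1, e2, e3⟩
  · refine (parabola_ne_of_sign ?_ ?_ h'.1 h'.2 h.1 h.2).symm
    · simp only [coef]; linarith
    · rw [e3]; positivity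
  · obtain ⟨n1, n2⟩ := nested_of_inside h1 h2 h'.1 h'.2
    refine parabola_ne_of_abs_lt ?_ ?_ ?_ h.1 h.2
    · rw [e3]
      refine (abs_short_lt_one j).trans_le ?_
      simp only [coef]
      rw [abs_neg, abs_of_nonneg (by positivity)]; linarith
    · rw [e1]; exact n1
    · rw [e2]; exact n2

theorem rim_ne_rim {flip : Bool} {i i' : Fin (2 * m + 2)} {j j' : Fin (L + 1)} {x : ℝ}
    (hne : (rim i j : Strand m L s) ≠ rim i' j')
    (h : (rim i j : Strand m L s).Inside x) (h' : (rim i' j' : Strand m L s).Inside x) :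
    (rim i j : Strand m L s).curve flip x ≠ (rim i' j' : Strand m L s).curve flip x := by
  wlog hii : j ≤ j' generalizing i i' j j'
  · exact (this hne.symm h' h (le_of_not_ge hii)).symm
  have hj : (j : ℝ) ≤ j' := by exact_mod_cast hii
  have hj0 : (0 : ℝ) ≤ j := by positivity
  rcases rim_inside h with ⟨q, h1, h2, e1, e2, e3⟩ | ⟨q, h1, h2, e1, e2, e3⟩ <;>
  rcases rim_inside h' with ⟨q', h1', h2', e1', e2', e3'⟩ | ⟨q', h1', h2', e1', e2', e3'⟩
  · have : i = i' := Fin.ext (by omega)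
    subst this
    have hlt : j < j' := lt_of_le_of_ne hii fun e => hne (by rw [e])
    have hlt' : (j : ℝ) < j' := by exact_mod_cast hlt
    refine parabola_ne_of_abs_lt ?_ (by rw [e1, e1']) (by rw [e2, e2']) h.1 h.2
    rw [e3, e3', abs_of_nonneg (by positivity), abs_of_nonneg (by positivity)]
    linarith
  · obtain ⟨n1, n2⟩ := nested_of_inside h1' h2' h.1 h.2
    refine (parabola_ne_of_abs_lt ?_ ?_ ?_ h'.1 h'.2).symm
    · rw [e3, e3']
      refine (abs_short_lt_one _).trans_le ?_
      rw [abs_of_nonneg (by positivity)]; linarith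
    · rw [e1']; exact n1
    · rw [e2']; exact n2
  · obtain ⟨n1, n2⟩ := nested_of_inside h1 h2 h'.1 h'.2
    refine parabola_ne_of_abs_lt ?_ ?_ ?_ h.1 h.2
    · rw [e3, e3']
      refine (abs_short_lt_one _).trans_le ?_
      rw [abs_of_nonneg (by positivity)]; linarith
    · rw [e1]; exact n1
    · rw [e2]; exact n2
  · obtain ⟨n1, n2⟩ := nested_of_inside h1 h2 h'.1 h'.2
    have hi1 : i'.val ≤ i.val := by exact_mod_cast e1' ▸ n1
    have hi2 : i.val + 1 ≤ i'.val + 1 := by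
      rw [e2'] at n2; exact_mod_cast n2
    have : i = i' := Fin.ext (by omega)
    subst this
    have hlt : j < j' := lt_of_le_of_ne hii fun e => hne (by rw [e])
    have hlt' : (j : ℝ) < j' := by exact_mod_cast hlt
    refine parabola_ne_of_abs_lt ?_ (by rw [e1, e1']) (by rw [e2, e2']) h.1 h.2
    rw [e3, e3', abs_neg, abs_neg, abs_of_nonneg (by positivity), abs_of_nonneg (by positivity)]
    exact div_lt_div_of_pos_right hlt' (by positivity)

theorem long_ne_long {flip : Bool} {t t' : Fin s} {x : ℝ} (hne : t ≠ t')
    (h : (long t : Strand m L s).Inside x) :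
    (long t : Strand m L s).curve flip x ≠ (long t' : Strand m L s).curve flip x := by
  intro e
  simp only [curve, coef] at e
  have hp : ((x - ((long t : Strand m L s).lo : ℝ)) * ((long t : Strand m L s).hi - x)) ≠ 0 :=
    (mul_pos (by linarith [h.1]) (by linarith [h.2])).ne'
  have := mul_right_cancel₀ hp e
  apply hne
  ext
  have : (t : ℝ) = t' := by linarith
  exact_mod_cast this

theorem exc_of_chord_chord {flip : Bool} {a b : Fin m} {x : ℝ} (hne : a ≠ b)
    (h : (chord a : Strand m L s).Inside x) (h' : (chord b : Strand m L s).Inside x)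
    (e : (chord a : Strand m L s).curve flip x = (chord b : Strand m L s).curve flip x) :
    Exc flip (chord a : Strand m L s) (chord b) x := by
  left
  have same : ((x - ((chord a : Strand m L s).lo : ℝ)) * ((chord a : Strand m L s).hi - x)) =
      ((x - ((chord b : Strand m L s).lo : ℝ)) * ((chord b : Strand m L s).hi - x)) →
      2 * x = a + b + m + 3 := by
    intro e
    simp only [lo, hi] at e
    push_cast at e
    have hab : (a : ℝ) - b ≠ 0 := by
      rw [sub_ne_zero]
      intro h; exact hne (Fin.ext (by exact_mod_cast h))
    have : ((a : ℝ) - b) * (2 * x - (a + b + m + 3)) = 0 := by linear_combination e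
    have := (mul_eq_zero.1 this).resolve_left hab
    linarith
  by_cases ha : flip = true ∧ a.val + 1 = m <;> by_cases hb : flip = true ∧ b.val + 1 = m
  · exact absurd (Fin.ext (by omega)) hne
  · exact absurd e (parabola_ne_of_sign (by simp [coef, ha]) (by simp [coef, hb]) h.1 h.2 h'.1 h'.2)
  · exact absurd e.symm
      (parabola_ne_of_sign (by simp [coef, hb]) (by simp [coef, ha]) h'.1 h'.2 h.1 h.2)
  · refine ⟨a, b, rfl, rfl, hne, by tauto, same ?_⟩
    simpa only [curve, coef, if_neg ha, if_neg hb, one_mul] using e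

theorem exc_of_chord_long {flip : Bool} {a : Fin m} {t : Fin s} {x : ℝ}
    (h : (chord a : Strand m L s).Inside x) (h' : (long t : Strand m L s).Inside x)
    (e : (chord a : Strand m L s).curve flip x = (long t : Strand m L s).curve flip x) :
    Exc flip (chord a : Strand m L s) (long t) x := by
  right
  by_cases ha : flip = true ∧ a.val + 1 = m
  · exact ⟨a, t, rfl, rfl, ha⟩
  · refine absurd e.symm (parabola_ne_of_sign ?_ ?_ h'.1 h'.2 h.1 h.2)
    · simp only [coef]
      have : (0 : ℝ) ≤ t := by positivity
      linarith
    · simp [coef, ha]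

theorem exc_or_exc {flip : Bool} {c c' : Strand m L s} {x : ℝ} (hne : c ≠ c')
    (h : c.Inside x) (h' : c'.Inside x) (e : c.curve flip x = c'.curve flip x) :
    Exc flip c c' x ∨ Exc flip c' c x := by
  rcases c with ⟨i, j⟩ | t | a <;> rcases c' with ⟨i', j'⟩ | t' | a'
  · exact absurd e (rim_ne_rim hne h h')
  · exact absurd e (rim_ne_long h h')
  · exact absurd e (rim_ne_chord h h')
  · exact absurd e.symm (rim_ne_long h' h)
  · exact absurd e (long_ne_long (fun h => hne (by rw [h])) h)
  · exact Or.inr (exc_of_chord_long h' h e.symm)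
  · exact absurd e.symm (rim_ne_chord h' h)
  · exact Or.inl (exc_of_chord_long h h' e)
  · exact Or.inl (exc_of_chord_chord (fun h => hne (by rw [h])) h h' e)

theorem chord_long_unique {flip : Bool} {a : Fin m} {t : Fin s} (hf : flip = true ∧ a.val + 1 = m)
    {x x' : ℝ} (h1 : (chord a : Strand m L s).Inside x) (h2 : (long t : Strand m L s).Inside x)
    (h1' : (chord a : Strand m L s).Inside x') (h2' : (long t : Strand m L s).Inside x')
    (e : (chord a : Strand m L s).curve flip x = (long t : Strand m L s).curve flip x)
    (e' : (chord a : Strand m L s).curve flip x' = (long t : Strand m L s).curve flip x') :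
    x = x' := by
  have hm : (a : ℝ) = m - 1 := by
    have : (a : ℝ) + 1 = m := by exact_mod_cast hf.2
    linarith
  have hm1 : (1 : ℝ) ≤ m := by exact_mod_cast (by omega : 1 ≤ m)
  simp only [Inside, curve, coef, if_pos hf, lo, hi] at *
  push_cast at *
  rw [hm] at h1 h1' e e'
  rw [Fin.val_zero, Nat.cast_zero] at h2 h2' e e'
  have ht : (0 : ℝ) ≤ t := by positivity
  by_contra hne
  have : (x - x') * (((t : ℝ) + 1) * (x + x' - (m + 1)) + (3 * m + 1 - x - x')) = 0 := by
    linear_combination e' - e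
  have h3 := (mul_eq_zero.1 this).resolve_left (sub_ne_zero.2 hne)
  have h4 : 0 < ((t : ℝ) + 1) * (x + x' - (m + 1)) := mul_pos (by linarith) (by linarith)
  linarith

/-- The edges of all the strands form a graph. -/
def graph (m L s : ℕ) : SimpleGraph (Vtx m L s) :=
  SimpleGraph.fromEdgeSet (⋃ c : Strand m L s, c.edges)

open Classical in
/-- A strand containing a given edge. -/
def ofEdge (e : Sym2 (Vtx m L s)) : Strand m L s :=
  if h : ∃ c : Strand m L s, e ∈ c.edges then h.choose else rim 0 0

theorem graph_adj {u v : Vtx m L s} :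
    (graph m L s).Adj u v ↔ (∃ c : Strand m L s, s(u, v) ∈ c.edges) ∧ u ≠ v := by
  simp [graph]

theorem mem_edges_ofEdge {u v : Vtx m L s} (h : (graph m L s).Adj u v) :
    s(u, v) ∈ (ofEdge s(u, v)).edges := by
  have h' := (graph_adj.1 h).1
  rw [ofEdge, dif_pos h']
  exact h'.choose_spec

/-- The position of a vertex. -/
def pos (flip : Bool) (v : Vtx m L s) : ℝ × ℝ := (posX v, posY flip v)

theorem mid_ofVtx (v : Vtx m L s) : (ofVtx v).mid = v := by
  rcases v with ⟨i, j⟩ | t <;> rfl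

theorem node_or_middle (v : Vtx m L s) : (∃ i, v = node i) ∨
    (posX v = (((ofVtx v).lo : ℝ) + (ofVtx v).hi) / 2 ∧ ∀ flip, (ofVtx v).coef flip ≠ 0) := by
  rcases (ofVtx v).ofVtx_mid with h | h | h
  · exact Or.inl ⟨_, (mid_ofVtx v).symm.trans h⟩
  · exact Or.inl ⟨_, (mid_ofVtx v).symm.trans h⟩
  · rw [mid_ofVtx] at h
    exact Or.inr ⟨h.1, h.2.2⟩

theorem ofVtx_ne_chord (v : Vtx m L s) (a : Fin m) : ofVtx v ≠ chord a := by
  rcases v with ⟨i, j⟩ | t <;> simp [ofVtx]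

theorem hi_eq_of_coef_eq_zero {flip : Bool} {c : Strand m L s} (h : c.coef flip = 0) :
    c.hi.val = c.lo.val + 1 := by
  rcases c with ⟨i, j⟩ | t | a
  · rw [lo_rim]
    by_cases h' : i.val = 2 * m + 1
    · simp only [coef, if_pos h'] at h
      have : (0 : ℝ) < 2 + j := by positivity
      linarith
    · simp only [hi, if_neg h']
      omega
  · simp only [coef] at h
    have : (0 : ℝ) < t + 1 := by positivity
    linarith
  · simp only [coef] at h
    split_ifs at h <;> norm_num at h

theorem curve_ne_zero {flip : Bool} {c : Strand m L s} {x : ℝ} (h : c.Inside x)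
    (hc : c.coef flip ≠ 0) : c.curve flip x ≠ 0 :=
  mul_ne_zero hc (mul_pos (by linarith [h.1]) (by linarith [h.2])).ne'

theorem inside_middle (c : Strand m L s) : c.Inside (((c.lo : ℝ) + c.hi) / 2) := by
  have := c.lo_lt_hi'
  constructor <;> linarith

theorem curve_node_ne_zero {flip : Bool} {c : Strand m L s} {i : ℕ} (h : c.Inside (i : ℝ)) :
    c.curve flip i ≠ 0 := by
  refine curve_ne_zero h fun hc => ?_
  have h1 : c.lo.val < i := by exact_mod_cast h.1
  have h2 : i < c.hi.val := by exact_mod_cast h.2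
  have := hi_eq_of_coef_eq_zero hc
  omega

theorem pos_injective (flip : Bool) : Function.Injective (pos flip : Vtx m L s → ℝ × ℝ) := by
  intro u v h
  obtain ⟨hx, hy⟩ := Prod.ext_iff.1 h
  simp only [pos] at hx hy
  rcases node_or_middle u with ⟨i, hu⟩ | ⟨hu, hu'⟩ <;> rcases node_or_middle v with ⟨j, hv⟩ | ⟨hv, hv'⟩
  · subst hu hv
    rw [posX_node, posX_node] at hx
    rw [Fin.ext (by exact_mod_cast hx : i.val = j.val)]
  · subst hu
    rw [posY_node, posY, hv] at hy
    exact absurd hy.symm (curve_ne_zero (inside_middle _) (hv' _))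
  · subst hv
    rw [posY_node, posY, hu] at hy
    exact absurd hy (curve_ne_zero (inside_middle _) (hu' _))
  · by_cases hne : ofVtx u = ofVtx v
    · rw [← mid_ofVtx u, hne, mid_ofVtx]
    · rw [posY, posY, ← hx] at hy
      have h1 := inside_middle (ofVtx u)
      have h2 := inside_middle (ofVtx v)
      rw [← hu] at h1
      rw [← hv, ← hx] at h2
      rcases exc_or_exc hne h1 h2 hy with (⟨a, b, h, -⟩ | ⟨a, t, h, -⟩) | ⟨a, b, h, -⟩ | ⟨a, t, h, -⟩ <;>
        exact absurd h (ofVtx_ne_chord _ _)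

theorem exc_cases {flip : Bool} {c c' : Strand m L s} {x : ℝ} (h : Exc flip c c' x ∨ Exc flip c' c x) :
    (∃ a b, c = chord a ∧ c' = chord b ∧ a ≠ b ∧
      (flip = true ∧ a.val + 1 = m ↔ flip = true ∧ b.val + 1 = m) ∧ 2 * x = a + b + m + 3) ∨
    (∃ a t, c = chord a ∧ c' = long t ∧ flip = true ∧ a.val + 1 = m) ∨
    (∃ a t, c' = chord a ∧ c = long t ∧ flip = true ∧ a.val + 1 = m) := by
  rcases h with (h | h) | ⟨a, b, h1, h2, h3, h4, h5⟩ | h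
  · exact Or.inl h
  · exact Or.inr (Or.inl h)
  · exact Or.inl ⟨b, a, h2, h1, h3.symm, h4.symm, by linarith⟩
  · exact Or.inr (Or.inr h)

theorem crossing_unique {flip : Bool} {c c' : Strand m L s} (hne : c ≠ c') {x x' : ℝ}
    (h1 : c.Inside x) (h2 : c'.Inside x) (h1' : c.Inside x') (h2' : c'.Inside x')
    (e : c.curve flip x = c'.curve flip x) (e' : c.curve flip x' = c'.curve flip x') : x = x' := by
  rcases exc_cases (exc_or_exc hne h1 h2 e) with
    ⟨a, b, rfl, rfl, -, -, h⟩ | ⟨a, t, rfl, rfl, hf⟩ | ⟨a, t, rfl, rfl, hf⟩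
  · rcases exc_cases (exc_or_exc hne h1' h2' e') with
      ⟨a', b', ha, hb, -, -, h'⟩ | ⟨a', t, -, h, -⟩ | ⟨a', t, -, h, -⟩
    · cases ha; cases hb
      linarith
    · cases h
    · cases h
  · exact chord_long_unique hf h1 h2 h1' h2' e e'
  · exact chord_long_unique hf h2 h1 h2' h1' e.symm e'.symm

theorem not_triple {flip : Bool} {c₁ c₂ c₃ : Strand m L s} (h12 : c₁ ≠ c₂) (h13 : c₁ ≠ c₃)
    (h23 : c₂ ≠ c₃) {x : ℝ} (h1 : c₁.Inside x) (h2 : c₂.Inside x) (h3 : c₃.Inside x)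
    (e12 : c₁.curve flip x = c₂.curve flip x) (e13 : c₁.curve flip x = c₃.curve flip x) : False := by
  have key : ∀ a b c : Fin m, b ≠ c → 2 * x = a + b + m + 3 → 2 * x = a + c + m + 3 → False := by
    intro a b c hbc h h'
    apply hbc
    ext
    have : (b : ℝ) = c := by linarith
    exact_mod_cast this
  rcases exc_cases (exc_or_exc h12 h1 h2 e12) with
    ⟨a, b, rfl, rfl, q1, q2, q3⟩ | ⟨a, t, rfl, rfl, hf⟩ | ⟨a, t, rfl, rfl, hf⟩ <;>
  rcases exc_cases (exc_or_exc h13 h1 h3 e13) with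
    ⟨a', b', ha, rfl, q1', q2', q3'⟩ | ⟨a', t', ha, rfl, hf'⟩ | ⟨a', t', rfl, ha, hf'⟩ <;>
  rcases exc_cases (exc_or_exc h23 h2 h3 (e12.symm.trans e13)) with
    ⟨a'', b'', hb, hc, q1'', q2'', q3''⟩ | ⟨a'', t'', hb, hc, hf''⟩ | ⟨a'', t'', hb, hc, hf''⟩ <;>
  simp only [chord.injEq, long.injEq, reduceCtorEq] at ha hb hc <;> subst_vars
  · exact key _ _ _ (fun h => h23 (by rw [h])) q3 q3'
  · exact q1 (Fin.ext (by omega))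
  · exact q1' (Fin.ext (by omega))
  · exact h23 (congrArg chord (Fin.ext (by omega)))

theorem edge_cases {c : Strand m L s} {u v : Vtx m L s} (h : s(u, v) ∈ c.edges) :
    ((u = node c.lo ∧ v = c.mid) ∨ (u = c.mid ∧ v = node c.lo)) ∨
      ((u = c.mid ∧ v = node c.hi) ∨ (u = node c.hi ∧ v = c.mid)) := by
  simpa [edges] using h

theorem mem_edges_swap {c : Strand m L s} {u v : Vtx m L s} (h : s(u, v) ∈ c.edges) :
    s(v, u) ∈ c.edges := by
  rwa [Sym2.eq_swap]

theorem posX_ne {c : Strand m L s} {u v : Vtx m L s} (h : s(u, v) ∈ c.edges) (hne : u ≠ v) :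
    posX u ≠ posX v := by
  intro e
  rcases edge_cases h with (⟨rfl, rfl⟩ | ⟨rfl, rfl⟩) | ⟨rfl, rfl⟩ | ⟨rfl, rfl⟩ <;>
    rw [posX_node] at e
  · exact hne (eq_node_lo e.symm).symm
  · exact hne (eq_node_lo e)
  · exact hne (eq_node_hi e)
  · exact hne (eq_node_hi e.symm).symm

theorem on_curve (flip : Bool) {c : Strand m L s} {u v : Vtx m L s} (h : s(u, v) ∈ c.edges) :
    (c.lo : ℝ) ≤ posX u ∧ posX u ≤ c.hi ∧ posY flip u = c.curve flip (posX u) := by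
  have h1 := c.lo_lt_hi'
  have h2 := c.posX_mid_mem
  have h3 := c.posY_mid flip
  rcases edge_cases h with (⟨rfl, rfl⟩ | ⟨rfl, rfl⟩) | ⟨rfl, rfl⟩ | ⟨rfl, rfl⟩
  · simp [curve_lo, h1.le]
  · exact ⟨h2.1, h2.2, h3⟩
  · exact ⟨h2.1, h2.2, h3⟩
  · simp [curve_hi, h1.le]

/-- The arc with which an edge is drawn. -/
def edgeArc (flip : Bool) (u v : Vtx m L s) (t : ℝ) : ℝ × ℝ :=
  ((1 - t) * posX u + t * posX v,
    (ofEdge s(u, v)).curve flip ((1 - t) * posX u + t * posX v))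

theorem mem_edgeArc {flip : Bool} {u v : Vtx m L s} {p : ℝ × ℝ}
    (h : p ∈ edgeArc flip u v '' Icc 0 1) :
    p.1 ∈ uIcc (posX u) (posX v) ∧ p.2 = (ofEdge s(u, v)).curve flip p.1 := by
  obtain ⟨t, ht, rfl⟩ := h
  refine ⟨?_, rfl⟩
  rw [← segment_eq_uIcc]
  exact ⟨1 - t, t, by linarith [ht.2], ht.1, by ring, by simp [edgeArc]⟩

theorem inside_of_mem {flip : Bool} {u v : Vtx m L s} (h : (graph m L s).Adj u v) {p : ℝ × ℝ}
    (hp : p ∈ edgeArc flip u v '' Icc 0 1) (hp' : p ∉ range (pos flip : Vtx m L s → ℝ × ℝ)) :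
    (ofEdge s(u, v)).Inside p.1 ∧ p.2 = (ofEdge s(u, v)).curve flip p.1 := by
  obtain ⟨h1, h2⟩ := mem_edgeArc hp
  have hu := on_curve flip (mem_edges_ofEdge h)
  have hv := on_curve flip (mem_edges_swap (mem_edges_ofEdge h))
  rw [uIcc, mem_Icc] at h1
  refine ⟨⟨lt_of_le_of_ne ((le_min hu.1 hv.1).trans h1.1) ?_,
    lt_of_le_of_ne (h1.2.trans (max_le hu.2.1 hv.2.1)) ?_⟩, h2⟩
  · intro e
    rw [← e, curve_lo] at h2
    exact hp' ⟨node (ofEdge s(u, v)).lo, Prod.ext (by simp [pos, e]) (by simp [pos, h2])⟩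
  · intro e
    rw [e, curve_hi] at h2
    exact hp' ⟨node (ofEdge s(u, v)).hi, Prod.ext (by simp [pos, e]) (by simp [pos, h2])⟩

theorem ofEdge_ne_of_inter {flip : Bool} {u v w z : Vtx m L s} (h : (graph m L s).Adj u v)
    (h' : (graph m L s).Adj w z) (hne : s(u, v) ≠ s(w, z)) {p : ℝ × ℝ}
    (hp : p ∈ edgeArc flip u v '' Icc 0 1) (hp' : p ∈ edgeArc flip w z '' Icc 0 1)
    (hp'' : p ∉ range (pos flip : Vtx m L s → ℝ × ℝ)) : ofEdge s(u, v) ≠ ofEdge s(w, z) := by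
  intro e
  obtain ⟨h1, h2⟩ := mem_edgeArc hp
  obtain ⟨h3, -⟩ := mem_edgeArc hp'
  have hu := mem_edges_ofEdge h
  have hw := mem_edges_ofEdge h'
  rw [← e] at hw
  set c := ofEdge s(u, v)
  have key : p.1 = posX c.mid → False := by
    intro hx
    rw [hx, ← posY_mid] at h2
    exact hp'' ⟨c.mid, Prod.ext hx.symm h2.symm⟩
  obtain ⟨m1, m2⟩ := c.posX_mid_mem
  apply key
  have l1 : uIcc (c.lo : ℝ) (posX c.mid) = Icc _ _ := uIcc_of_le m1
  have l2 : uIcc (posX c.mid) (c.hi : ℝ) = Icc _ _ := uIcc_of_le m2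
  have hpos : ∀ {a b : Vtx m L s}, s(a, b) ∈ c.edges → p.1 ∈ uIcc (posX a) (posX b) →
      (s(a, b) = s(node c.lo, c.mid) ∧ p.1 ≤ posX c.mid) ∨
      (s(a, b) = s(c.mid, node c.hi) ∧ posX c.mid ≤ p.1) := by
    intro a b hab hx
    rcases edge_cases hab with (⟨rfl, rfl⟩ | ⟨rfl, rfl⟩) | ⟨rfl, rfl⟩ | ⟨rfl, rfl⟩
    · rw [posX_node, l1] at hx; exact Or.inl ⟨rfl, hx.2⟩
    · rw [posX_node, uIcc_comm, l1] at hx; exact Or.inl ⟨Sym2.eq_swap, hx.2⟩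
    · rw [posX_node, l2] at hx; exact Or.inr ⟨rfl, hx.1⟩
    · rw [posX_node, uIcc_comm, l2] at hx; exact Or.inr ⟨Sym2.eq_swap, hx.1⟩
  rcases hpos hu h1 with ⟨e1, h1⟩ | ⟨e1, h1⟩ <;> rcases hpos hw h3 with ⟨e2, h2⟩ | ⟨e2, h2⟩
  · exact absurd (e1.trans e2.symm) hne
  · exact le_antisymm h1 h2
  · exact le_antisymm h2 h1
  · exact absurd (e1.trans e2.symm) hne

theorem edgeArc_avoids {flip : Bool} {u v : Vtx m L s} (h : (graph m L s).Adj u v) {t : ℝ}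
    (ht : t ∈ Ioo (0 : ℝ) 1) : edgeArc flip u v t ∉ range (pos flip : Vtx m L s → ℝ × ℝ) := by
  rintro ⟨w, hw⟩
  obtain ⟨hx, hy⟩ := Prod.ext_iff.1 hw
  simp only [pos, edgeArc] at hx hy
  rw [← hx] at hy
  have he := mem_edges_ofEdge h
  have he' := mem_edges_swap he
  have hne := posX_ne he h.ne
  have hu := on_curve flip he
  have hv := on_curve flip he'
  set c := ofEdge s(u, v)
  have hlt : min (posX u) (posX v) < posX w ∧ posX w < max (posX u) (posX v) := by
    rw [hx]
    rcases lt_or_gt_of_ne hne with h' | h'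
    · rw [min_eq_left h'.le, max_eq_right h'.le]
      constructor <;> nlinarith [ht.1, ht.2]
    · rw [min_eq_right h'.le, max_eq_left h'.le]
      constructor <;> nlinarith [ht.1, ht.2]
  have hin : c.Inside (posX w) :=
    ⟨(le_min hu.1 hv.1).trans_lt hlt.1, hlt.2.trans_le (max_le hu.2.1 hv.2.1)⟩
  have hends : w ≠ u ∧ w ≠ v := by
    constructor <;> rintro rfl <;> simp at hlt <;> grind
  rcases node_or_middle w with ⟨i, rfl⟩ | ⟨hm, hc⟩
  · rw [posY_node, posX_node] at hy
    rw [posX_node] at hin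
    exact curve_node_ne_zero hin hy.symm
  · by_cases hcw : ofVtx w = c
    · have : w = c.mid := by rw [← hcw, mid_ofVtx]
      rcases edge_cases he with (⟨-, h2⟩ | ⟨h2, -⟩) | ⟨h2, -⟩ | ⟨-, h2⟩ <;> rw [← this] at h2
      · exact hends.2 h2.symm
      · exact hends.1 h2.symm
      · exact hends.1 h2.symm
      · exact hends.2 h2.symm
    · have hin' := inside_middle (ofVtx w)
      rw [← hm] at hin'
      rcases exc_cases (exc_or_exc hcw hin' hin hy) with ⟨a, b, h, -⟩ | ⟨a, t, h, -⟩ | ⟨a, t, ha, h, -, h'⟩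
      · exact ofVtx_ne_chord _ _ h
      · exact ofVtx_ne_chord _ _ h
      · have h1 := hin.1
        rw [hm, h, ha] at h1
        simp only [lo, hi] at h1
        push_cast at h1
        have h2 : (a : ℝ) + 1 = m := by exact_mod_cast h'
        have h3 : (1 : ℝ) ≤ m := by exact_mod_cast (by omega : 1 ≤ m)
        simp at h1
        linarith

/-- The drawing of the graph on parabolas. -/
def drawing (m L s : ℕ) (flip : Bool) : Drawing (graph m L s) where
  vpos := pos flip
  vpos_inj := pos_injective flip
  arc := edgeArc flip
  arc_symm u v t := by
    have : (1 - t) * posX u + t * posX v = (1 - (1 - t)) * posX v + (1 - t) * posX u := by ring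
    rw [edgeArc, edgeArc, this, Sym2.eq_swap]
  arc_cont u v _ := by
    unfold edgeArc curve
    fun_prop
  arc_injOn u v h t _ t' _ e := by
    have hne := posX_ne (mem_edges_ofEdge h) h.ne
    have e1 := congrArg Prod.fst e
    simp only [edgeArc] at e1
    have : (t - t') * (posX v - posX u) = 0 := by linear_combination e1
    have := (mul_eq_zero.1 this).resolve_right (sub_ne_zero.2 hne.symm)
    linarith
  arc_start u v h := by
    have := (on_curve flip (mem_edges_ofEdge h)).2.2
    simp [edgeArc, pos, this]
  arc_end u v h := by
    have := (on_curve flip (mem_edges_swap (mem_edges_ofEdge h))).2.2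
    simp [edgeArc, pos, this]
  arc_avoids u v h t ht := edgeArc_avoids h ht
  inter_finite u v w z h h' hne := by
    have hs : (((edgeArc flip u v '' Icc 0 1) ∩ (edgeArc flip w z '' Icc 0 1)) \
        range (pos flip : Vtx m L s → ℝ × ℝ)).Subsingleton := by
      rintro p ⟨⟨h1, h2⟩, h3⟩ q ⟨⟨h4, h5⟩, h6⟩
      have hc := ofEdge_ne_of_inter h h' hne h1 h2 h3
      obtain ⟨i1, e1⟩ := inside_of_mem h h1 h3
      obtain ⟨i2, e2⟩ := inside_of_mem h' h2 h3
      obtain ⟨i4, e4⟩ := inside_of_mem h h4 h6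
      obtain ⟨i5, e5⟩ := inside_of_mem h' h5 h6
      have := crossing_unique hc i1 i2 i4 i5 (e1.symm.trans e2) (e4.symm.trans e5)
      exact Prod.ext this (by rw [e1, e4, this])
    refine ((finite_range (pos flip : Vtx m L s → ℝ × ℝ)).union hs.finite).subset fun p hp => ?_
    by_cases hp' : p ∈ range (pos flip : Vtx m L s → ℝ × ℝ)
    · exact Or.inl hp'
    · exact Or.inr ⟨hp, hp'⟩
  no_triple_point p hp u₁ v₁ u₂ v₂ u₃ v₃ h₁ h₂ h₃ h12 h13 h23 := by
    rintro ⟨p1, p2, p3⟩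
    obtain ⟨i1, e1⟩ := inside_of_mem h₁ p1 hp
    obtain ⟨i2, e2⟩ := inside_of_mem h₂ p2 hp
    obtain ⟨i3, e3⟩ := inside_of_mem h₃ p3 hp
    exact not_triple (ofEdge_ne_of_inter h₁ h₂ h12 p1 p2 hp)
      (ofEdge_ne_of_inter h₁ h₃ h13 p1 p3 hp) (ofEdge_ne_of_inter h₂ h₃ h23 p2 p3 hp)
      i1 i2 i3 (e1.symm.trans e2) (e1.symm.trans e3)

theorem crossing_strands {flip : Bool} {e f : Sym2 (Vtx m L s)} {p : ℝ × ℝ}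
    (h : (drawing m L s flip).Crossing e f p) :
    ofEdge e ≠ ofEdge f ∧ (ofEdge e).Inside p.1 ∧ (ofEdge f).Inside p.1 ∧
      p.2 = (ofEdge e).curve flip p.1 ∧ p.2 = (ofEdge f).curve flip p.1 := by
  induction e with | _ u v
  induction f with | _ w z
  obtain ⟨he, hf, hne, hpe, hpf, hp⟩ := h
  obtain ⟨i1, e1⟩ := inside_of_mem he hpe hp
  obtain ⟨i2, e2⟩ := inside_of_mem hf hpf hp
  exact ⟨ofEdge_ne_of_inter he hf hne hpe hpf hp, i1, i2, e1, e2⟩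

theorem crossing_cases {flip : Bool} {e f : Sym2 (Vtx m L s)} {p : ℝ × ℝ}
    (h : (drawing m L s flip).Crossing e f p) :
    (∃ a b, ofEdge e = chord a ∧ ofEdge f = chord b ∧ a ≠ b ∧
      (flip = true ∧ a.val + 1 = m ↔ flip = true ∧ b.val + 1 = m) ∧ 2 * p.1 = a + b + m + 3) ∨
    (∃ a t, ofEdge e = chord a ∧ ofEdge f = long t ∧ flip = true ∧ a.val + 1 = m) ∨
    (∃ a t, ofEdge f = chord a ∧ ofEdge e = long t ∧ flip = true ∧ a.val + 1 = m) := by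
  obtain ⟨hne, i1, i2, e1, e2⟩ := crossing_strands h
  exact exc_cases (exc_or_exc hne i1 i2 (e1.symm.trans e2))

theorem crossings_drawing_false_le (m L s : ℕ) :
    (drawing m L s false).crossings ≤ ∑ i ∈ Finset.range m, i := by
  let x : (Σ b : Fin m, Fin b) → ℝ := fun q => ((q.1 : ℝ) + q.2 + m + 3) / 2
  let g : (Σ b : Fin m, Fin b) → ℝ × ℝ := fun q =>
    (x q, (chord q.1 : Strand m L s).curve false (x q))
  have hsub : (drawing m L s false).crossingSet ⊆ range g := by
    rintro p ⟨e, f, h⟩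
    obtain ⟨-, -, -, h1, h2⟩ := crossing_strands h
    rcases crossing_cases h with ⟨a, b, ha, hb, hab, -, hx⟩ | ⟨_, _, -, -, h', -⟩ |
      ⟨_, _, -, -, h', -⟩
    · rw [ha] at h1
      rw [hb] at h2
      rcases lt_or_gt_of_ne hab with hlt | hlt
      · have hx' : x ⟨b, ⟨a, hlt⟩⟩ = p.1 := by simp only [x]; linarith
        exact ⟨⟨b, ⟨a, hlt⟩⟩, Prod.ext hx' (by simp only [g, hx', h2])⟩
      · have hx' : x ⟨a, ⟨b, hlt⟩⟩ = p.1 := by simp only [x]; linarith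
        exact ⟨⟨a, ⟨b, hlt⟩⟩, Prod.ext hx' (by simp only [g, hx', h1])⟩
    · cases h'
    · cases h'
  calc (drawing m L s false).crossings ≤ (range g).ncard := ncard_le_ncard hsub (finite_range g)
    _ ≤ Nat.card (Σ b : Fin m, Fin b) := by
      rw [← Set.image_univ, ← Set.ncard_univ]
      exact ncard_image_le
    _ = ∑ i ∈ Finset.range m, i := by
      rw [Nat.card_eq_fintype_card, Fintype.card_sigma, ← Fin.sum_univ_eq_sum_range]
      simp

/-- The rule deciding which of two crossing strands is charged for the crossing. -/
def Charged (k : ℕ) : Strand m L s → Strand m L s → Prop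
  | chord a, chord b => (a.val < b ∧ b.val ≤ a + k) ∨ b.val + k < a
  | long _, chord _ => True
  | _, _ => False

theorem exists_charged {k : ℕ} {p : ℝ × ℝ} (hp : p ∈ (drawing m L s true).crossingSet) :
    ∃ e f, (drawing m L s true).Crossing e f p ∧ Charged k (ofEdge e) (ofEdge f) := by
  obtain ⟨e, f, h⟩ := hp
  have h' : (drawing m L s true).Crossing f e p :=
    ⟨h.2.1, h.1, h.2.2.1.symm, h.2.2.2.2.1, h.2.2.2.1, h.2.2.2.2.2⟩
  rcases crossing_cases h with ⟨a, b, ha, hb, hab, -, hx⟩ | ⟨a, t, ha, hb, -⟩ | ⟨a, t, ha, hb, -⟩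
  · by_cases hc : (a.val < b ∧ b.val ≤ a + k) ∨ b.val + k < a
    · exact ⟨e, f, h, by rw [ha, hb]; exact hc⟩
    · refine ⟨f, e, h', ?_⟩
      rw [ha, hb]
      have : a.val ≠ b.val := fun h => hab (Fin.ext h)
      change (b.val < a ∧ a.val ≤ b + k) ∨ a.val + k < b
      omega
  · exact ⟨f, e, h', by rw [ha, hb]; trivial⟩
  · exact ⟨e, f, h, by rw [ha, hb]; trivial⟩

theorem ncard_charged_le {k : ℕ} (hk : 1 ≤ k) (e : Sym2 (Vtx (2 * k + 2) L s)) :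
    {p | ∃ f, (drawing (2 * k + 2) L s true).Crossing e f p ∧
      Charged k (ofEdge e) (ofEdge f)}.ncard ≤ k ∧
    {p | ∃ f, (drawing (2 * k + 2) L s true).Crossing e f p ∧
      Charged k (ofEdge e) (ofEdge f)}.Finite := by
  rcases hc : ofEdge e with ⟨i, j⟩ | t | a
  · have : {p | ∃ f, (drawing (2 * k + 2) L s true).Crossing e f p ∧
        Charged k (rim i j) (ofEdge f)} = ∅ :=
      eq_empty_of_forall_notMem fun p ⟨f, _, h⟩ => h
    rw [this]
    simp
  · have : {p | ∃ f, (drawing (2 * k + 2) L s true).Crossing e f p ∧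
        Charged k (long t) (ofEdge f)}.Subsingleton := by
      rintro p ⟨f, h, -⟩ q ⟨f', h', -⟩
      obtain ⟨-, i1, i2, e1, e2⟩ := crossing_strands h
      obtain ⟨-, i1', i2', e1', e2'⟩ := crossing_strands h'
      rw [hc] at i1 e1 i1' e1'
      rcases crossing_cases h with ⟨a, b, ha, -⟩ | ⟨a, b, ha, -⟩ | ⟨a, b, ha, -, -, hl⟩
      · rw [hc] at ha; cases ha
      · rw [hc] at ha; cases ha
      rcases crossing_cases h' with ⟨a', b', ha', -⟩ | ⟨a', b', ha', -⟩ | ⟨a', b', ha', -, -, hl'⟩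
      · rw [hc] at ha'; cases ha'
      · rw [hc] at ha'; cases ha'
      have : a' = a := Fin.ext (by omega)
      subst this
      rw [ha] at i2 e2
      rw [ha'] at i2' e2'
      have hx := crossing_unique (by simp) i1 i2 i1' i2' (e1.symm.trans e2) (e1'.symm.trans e2')
      exact Prod.ext hx (by rw [e1, e1', hx])
    exact ⟨((ncard_le_one this.finite).2 fun _ ha _ hb => this ha hb).trans hk, this.finite⟩
  · let x : ℕ → ℝ := fun b => ((a : ℝ) + b + (2 * k + 2 : ℕ) + 3) / 2
    let g : ℕ → ℝ × ℝ := fun b => (x b, (chord a : Strand (2 * k + 2) L s).curve true (x b))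
    let B : Finset ℕ := if a.val ≤ 2 * k then
      Finset.Ioc a.val (min (a + k) (2 * k)) ∪ Finset.range (a - k) else ∅
    have hB : B.card ≤ k := by
      simp only [B]
      split_ifs with h
      · refine (Finset.card_union_le _ _).trans ?_
        rw [Nat.card_Ioc, Finset.card_range]
        omega
      · simp
    have hsub : {p | ∃ f, (drawing (2 * k + 2) L s true).Crossing e f p ∧
        Charged k (chord a) (ofEdge f)} ⊆ (B.image g : Finset (ℝ × ℝ)) := by
      rintro p ⟨f, h, hch⟩
      obtain ⟨-, -, -, e1, -⟩ := crossing_strands h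
      rw [hc] at e1
      rcases crossing_cases h with ⟨a', b, ha, hb, hab, hl, hx⟩ | ⟨a', b, -, hb, -⟩ | ⟨a', b, -, ha, -⟩
      · rw [hc] at ha
        cases ha
        rw [hb] at hch
        have hx' : x b = p.1 := by simp only [x]; linarith
        rw [Finset.coe_image]
        refine ⟨b, ?_, Prod.ext hx' (by simp only [g, hx', e1])⟩
        have hab' : a.val ≠ b.val := fun h => hab (Fin.ext h)
        have hch' : (a.val < b ∧ b.val ≤ a + k) ∨ b.val + k < a := hch
        simp only [true_and] at hl
        have ha2 : a.val ≤ 2 * k := by omega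
        simp only [B, if_pos ha2, Finset.coe_union, Set.mem_union, Finset.mem_coe, Finset.mem_Ioc,
          Finset.mem_range, le_min_iff]
        omega
      · rw [hb] at hch
        exact hch.elim
      · rw [hc] at ha
        cases ha
    refine ⟨(ncard_le_ncard hsub (Finset.finite_toSet _)).trans ?_,
      (Finset.finite_toSet _).subset hsub⟩
    rw [ncard_coe_finset]
    exact Finset.card_image_le.trans hB

theorem isKGapPlanar_drawing_true {k : ℕ} (hk : 1 ≤ k) (L s : ℕ) :
    (drawing (2 * k + 2) L s true).IsKGapPlanar k := by
  classical
  refine ⟨fun p => if h : p ∈ (drawing (2 * k + 2) L s true).crossingSet then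
    (exists_charged (k := k) h).choose else s(node 0, node 0), ?_, fun e => ?_⟩
  · intro p hp
    obtain ⟨f, hf⟩ := (exists_charged (k := k) hp).choose_spec
    exact ⟨f, by simpa only [dif_pos hp] using hf.1⟩
  · obtain ⟨h1, h2⟩ := ncard_charged_le hk e
    refine (ncard_le_ncard ?_ h2).trans h1
    rintro p ⟨hp, he⟩
    simp only [dif_pos hp] at he
    have := (exists_charged (k := k) hp).choose_spec
    rw [he] at this
    exact this

end Strand

namespace Drawing

variable {V : Type} {G : SimpleGraph V} (Γ : Drawing G)

theorem Crossing.symm {Γ : Drawing G} {e f : Sym2 V} {p : ℝ × ℝ} (h : Γ.Crossing e f p) :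
    Γ.Crossing f e p :=
  ⟨h.2.1, h.1, h.2.2.1.symm, h.2.2.2.2.1, h.2.2.2.1, h.2.2.2.2.2⟩

theorem finite_crossingSet [Finite V] : Γ.crossingSet.Finite := by
  have : Γ.crossingSet ⊆ ⋃ q ∈ {q : Sym2 V × Sym2 V | q.1 ∈ G.edgeSet ∧ q.2 ∈ G.edgeSet ∧ q.1 ≠ q.2},
      Γ.img q.1 ∩ Γ.img q.2 := by
    rintro p ⟨e, f, h1, h2, h3, h4, h5, -⟩
    exact mem_biUnion (x := (e, f)) ⟨h1, h2, h3⟩ ⟨h4, h5⟩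
  refine ((toFinite _).biUnion ?_).subset this
  rintro ⟨e, f⟩ ⟨h1, h2, h3⟩
  induction e with | _ u v
  induction f with | _ w z
  exact Γ.inter_finite u v w z h1 h2 h3

theorem Crossing.eq_or_eq {Γ : Drawing G} {e f g : Sym2 V} {p : ℝ × ℝ} (h : Γ.Crossing e f p)
    (hg : g ∈ G.edgeSet) (hp : p ∈ Γ.img g) : g = e ∨ g = f := by
  by_contra! hne
  induction e with | _ u v
  induction f with | _ w z
  induction g with | _ x y
  obtain ⟨h1, h2, h3, h4, h5, h6⟩ := h
  exact Γ.no_triple_point p h6 u v w z x y h1 h2 hg h3 hne.1.symm hne.2.symm ⟨h4, h5, hp⟩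

/-- If there are more disjoint sets of edges than crossings, then one of the sets is not crossed by
edges outside of these sets. -/
theorem exists_not_crossing [Finite V] {ι : Type} [Fintype ι] (S : ι → Set (Sym2 V))
    (hS : ∀ i j, i ≠ j → Disjoint (S i) (S j)) (h : Γ.crossings < Fintype.card ι) :
    ∃ i, ∀ e ∈ S i, ∀ f, (∀ j, f ∉ S j) → ∀ p, ¬ Γ.Crossing e f p := by
  by_contra! hcon
  choose e he f hf p hp using hcon
  have hinj : Function.Injective p := by
    intro i j hij
    by_contra hne
    have hj := hp j
    rw [← hij] at hj
    rcases (hp i).eq_or_eq hj.1 hj.2.2.2.1 with h' | h'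
    · exact disjoint_left.1 (hS i j hne) (h' ▸ he i) (he j)
    · exact hf i j (h' ▸ he j)
  have hle : (range p).ncard ≤ Γ.crossingSet.ncard :=
    ncard_le_ncard (range_subset_iff.2 fun i => ⟨_, _, hp i⟩) Γ.finite_crossingSet
  rw [← image_univ, ncard_image_of_injective _ hinj, ncard_univ, Nat.card_eq_fintype_card] at hle
  exact absurd h (not_lt.2 hle)

theorem joinedIn_img {u v : V} (h : G.Adj u v) :
    JoinedIn (Γ.img s(u, v)) (Γ.vpos u) (Γ.vpos v) := by
  rw [← Γ.arc_start u v h, ← Γ.arc_end u v h]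
  exact JoinedIn.ofLine (Γ.arc_cont u v h) rfl rfl Subset.rfl

theorem mem_of_vpos_mem_img {e : Sym2 V} (he : e ∈ G.edgeSet) {w : V} (h : Γ.vpos w ∈ Γ.img e) :
    w ∈ e := by
  induction e with | _ u v
  obtain ⟨t, ht, hw⟩ := h
  rcases eq_or_lt_of_le ht.1 with h0 | h0
  · rw [← h0, Γ.arc_start u v he] at hw
    rw [← Γ.vpos_inj hw]
    exact Sym2.mem_mk_left _ _
  rcases eq_or_lt_of_le ht.2 with h1 | h1
  · rw [h1, Γ.arc_end u v he] at hw
    rw [← Γ.vpos_inj hw]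
    exact Sym2.mem_mk_right _ _
  · exact absurd ⟨w, hw.symm⟩ (Γ.arc_avoids u v he t ⟨h0, h1⟩)

theorem disjoint_img {e f : Sym2 V} (he : e ∈ G.edgeSet) (hf : f ∈ G.edgeSet)
    (hv : ∀ w, w ∈ e → w ∉ f) (hc : ∀ p, ¬ Γ.Crossing e f p) : Disjoint (Γ.img e) (Γ.img f) := by
  refine disjoint_left.2 fun p h1 h2 => ?_
  by_cases hp : p ∈ range Γ.vpos
  · obtain ⟨w, rfl⟩ := hp
    exact hv w (Γ.mem_of_vpos_mem_img he h1) (Γ.mem_of_vpos_mem_img hf h2)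
  · refine hc p ⟨he, hf, ?_, h1, h2, hp⟩
    rintro rfl
    induction e with | _ u v
    exact hv u (Sym2.mem_mk_left _ _) (Sym2.mem_mk_left _ _)

end Drawing

namespace Strand

variable {m L s : ℕ}

theorem eq_of_mid_eq_node {c : Strand m L s} {i : Fin (2 * m + 2)} (h : c.mid = node i) :
    (∃ j, c = rim j 0) ∨ ∃ a, c = chord a := by
  rcases c with ⟨j, l⟩ | t | a
  · simp only [mid, node, Sum.inl.injEq, Prod.mk.injEq] at h
    exact Or.inl ⟨j, by rw [h.2]⟩
  · simp [mid, node] at h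
  · exact Or.inr ⟨a, rfl⟩

theorem mid_rim_zero (i : Fin (2 * m + 2)) :
    (rim i 0 : Strand m L s).mid = node (rim i 0 : Strand m L s).lo ∨
      (rim i 0 : Strand m L s).mid = node (rim i 0 : Strand m L s).hi := by
  by_cases h : i.val = 2 * m + 1
  · right
    simp only [mid, node, hi, Sum.inl.injEq, Prod.mk.injEq, and_true]
    ext; simp [h]
  · left
    simp [mid, node, lo, h]

theorem mid_eq_or_eq {c : Strand m L s} {i : Fin (2 * m + 2)} (h : c.mid = node i) :
    c.mid = node c.lo ∨ c.mid = node c.hi := by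
  rcases eq_of_mid_eq_node h with ⟨j, rfl⟩ | ⟨a, rfl⟩
  · exact mid_rim_zero j
  · exact Or.inl rfl

theorem end_of_mem {c : Strand m L s} {e : Sym2 (Vtx m L s)} (he : e ∈ c.edges) {w : Vtx m L s}
    (hw : w ∈ e) : w = node c.lo ∨ w = node c.hi ∨ ((∀ i, w ≠ node i) ∧ w = c.mid ∧ ofVtx w = c) := by
  have hm : w = c.mid → w = node c.lo ∨ w = node c.hi ∨
      ((∀ i, w ≠ node i) ∧ w = c.mid ∧ ofVtx w = c) := by
    rintro rfl
    by_cases h : ∃ i, c.mid = node i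
    · obtain ⟨i, hi⟩ := h
      exact (mid_eq_or_eq hi).imp_right Or.inl
    · push Not at h
      rcases c.ofVtx_mid with h' | h' | h'
      · exact Or.inl h'
      · exact Or.inr (Or.inl h')
      · exact Or.inr (Or.inr ⟨h, rfl, h'.2.1⟩)
  rcases he with rfl | rfl <;> rcases Sym2.mem_iff.1 hw with h | h
  · exact Or.inl h
  · exact hm h
  · exact hm h
  · exact Or.inr (Or.inl h)

/-- The edges of distinct strands are distinct. -/
theorem eq_of_mem_edges (hm : 1 ≤ m) {c c' : Strand m L s} {e : Sym2 (Vtx m L s)}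
    (he : ¬ e.IsDiag) (h : e ∈ c.edges) (h' : e ∈ c'.edges) : c = c' := by
  have key : ∀ c : Strand m L s, e ∈ c.edges → (∀ w ∈ e, ∃ i, w = node i) →
      e = s(node c.lo, node c.hi) ∧ ∃ i, c.mid = node i := by
    intro c h hn
    have hmid : c.mid ∈ e := by
      rcases h with rfl | rfl
      · exact Sym2.mem_mk_right _ _
      · exact Sym2.mem_mk_left _ _
    obtain ⟨i, hi⟩ := hn _ hmid
    refine ⟨?_, i, hi⟩
    rcases mid_eq_or_eq hi with h1 | h1 <;> rcases h with rfl | rfl <;> rw [h1] at he ⊢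
    · exact absurd rfl he
    · exact absurd rfl he
  by_cases hn : ∀ w ∈ e, ∃ i, w = node i
  · obtain ⟨e1, i, hi⟩ := key c h hn
    obtain ⟨e2, i', hi'⟩ := key c' h' hn
    rw [e1] at e2
    have hlo : c.lo = c'.lo ∧ c.hi = c'.hi := by
      have l1 := c.lo_lt_hi
      have l2 := c'.lo_lt_hi
      rcases Sym2.eq_iff.1 e2 with ⟨h1, h2⟩ | ⟨h1, h2⟩
      · exact ⟨node_injective h1, node_injective h2⟩
      · have h3 := congrArg Fin.val (node_injective h1)
        have h4 := congrArg Fin.val (node_injective h2)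
        omega
    obtain ⟨h1, h2⟩ := hlo
    have h1 := congrArg Fin.val h1
    have h2 := congrArg Fin.val h2
    rcases eq_of_mid_eq_node hi with ⟨j, rfl⟩ | ⟨a, rfl⟩ <;>
      rcases eq_of_mid_eq_node hi' with ⟨j', rfl⟩ | ⟨a', rfl⟩
    · rw [lo_rim, lo_rim] at h1
      simp only [Strand.hi] at h2
      have : j = j' := by
        ext
        split_ifs at h1 <;> omega
      rw [this]
    · rw [lo_rim] at h1
      simp only [Strand.hi, lo] at h1 h2
      split_ifs at h1
      omega
    · rw [lo_rim] at h1
      simp only [Strand.hi, lo] at h1 h2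
      split_ifs at h1
      omega
    · simp only [lo] at h1
      exact congrArg chord (Fin.ext (by omega))
  · push Not at hn
    obtain ⟨w, hw, hn⟩ := hn
    rcases end_of_mem h hw with h1 | h1 | ⟨-, -, h1⟩
    · exact absurd h1 (hn _)
    · exact absurd h1 (hn _)
    rcases end_of_mem h' hw with h2 | h2 | ⟨-, -, h2⟩
    · exact absurd h2 (hn _)
    · exact absurd h2 (hn _)
    exact h1.symm.trans h2

/-- The set on which a strand is drawn. -/
def trace (Γ : Drawing (graph m L s)) (c : Strand m L s) : Set (ℝ × ℝ) :=
  ⋃ e ∈ c.edges ∩ (graph m L s).edgeSet, Γ.img e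

theorem joinedIn_trace (Γ : Drawing (graph m L s)) (c : Strand m L s) :
    JoinedIn (c.trace Γ) (Γ.vpos (node c.lo)) (Γ.vpos (node c.hi)) := by
  have key : ∀ u v, s(u, v) ∈ c.edges → u ≠ v →
      JoinedIn (c.trace Γ) (Γ.vpos u) (Γ.vpos v) := by
    intro u v h hne
    have hadj : (graph m L s).Adj u v := graph_adj.2 ⟨⟨c, h⟩, hne⟩
    exact (Γ.joinedIn_img hadj).mono
      (subset_biUnion_of_mem (u := Γ.img) (show s(u, v) ∈ c.edges ∩ _ from ⟨h, hadj⟩))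
  have hne : (node c.lo : Vtx m L s) ≠ node c.hi := fun h =>
    c.lo_lt_hi.ne (congrArg Fin.val (node_injective h))
  by_cases h1 : node c.lo = c.mid
  · refine key _ _ ?_ hne
    rw [h1]; exact Or.inr rfl
  · by_cases h2 : c.mid = node c.hi
    · refine key _ _ ?_ hne
      rw [← h2]; exact Or.inl rfl
    · exact (key _ _ (Or.inl rfl) h1).trans (key _ _ (Or.inr rfl) h2)

/-- No edge of the first strand crosses an edge of the second one. -/
def NotCrossing (Γ : Drawing (graph m L s)) (c c' : Strand m L s) : Prop :=
  ∀ e ∈ c.edges, ∀ f ∈ c'.edges, ∀ p, ¬ Γ.Crossing e f p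

theorem disjoint_trace {Γ : Drawing (graph m L s)} {c c' : Strand m L s}
    (h : NotCrossing Γ c c') (h1 : c.lo ≠ c'.lo) (h2 : c.lo ≠ c'.hi) (h3 : c.hi ≠ c'.lo)
    (h4 : c.hi ≠ c'.hi) : Disjoint (c.trace Γ) (c'.trace Γ) := by
  simp only [trace, disjoint_iUnion_left, disjoint_iUnion_right]
  rintro f ⟨hf, hf'⟩ e ⟨he, he'⟩
  refine Γ.disjoint_img he' hf' (fun w hw hw' => ?_) (h e he f hf)
  rcases end_of_mem he hw with q | q | ⟨q, -, q'⟩ <;>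
    rcases end_of_mem hf hw' with r | r | ⟨r, -, r'⟩
  · exact h1 (node_injective (q.symm.trans r))
  · exact h2 (node_injective (q.symm.trans r))
  · exact r _ q
  · exact h3 (node_injective (q.symm.trans r))
  · exact h4 (node_injective (q.symm.trans r))
  · exact r _ q
  · exact q _ r
  · exact q _ r
  · exact h1 (by rw [q'.symm.trans r'])

theorem exists_notCrossing (hm : 1 ≤ m) (Γ : Drawing (graph m L s)) {ι : Type} [Fintype ι]
    (c : ι → Strand m L s) (hc : Function.Injective c) (h : Γ.crossings < Fintype.card ι) :
    ∃ i, ∀ c', (∀ j, c' ≠ c j) → NotCrossing Γ (c i) c' := by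
  obtain ⟨i, hi⟩ := Γ.exists_not_crossing (fun i => {e | e ∈ (c i).edges ∧ ¬ e.IsDiag})
    (fun i j hij => disjoint_left.2 fun e h1 h2 =>
      hij (hc (eq_of_mem_edges hm h1.2 h1.1 h2.1))) h
  refine ⟨i, fun c' hc' e he f hf p hp => hi e ⟨he, ?_⟩ f ?_ p hp⟩
  · exact (graph m L s).not_isDiag_of_mem_edgeSet hp.1
  · rintro j ⟨h1, h2⟩
    exact hc' j (eq_of_mem_edges hm h2 hf h1)

end Strand

theorem not_K33_joinedIn_prod (x : Fin 6 → ℝ × ℝ) (hx : Function.Injective x)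
    (F : Fin 6 → Fin 6 → Set (ℝ × ℝ))
    (hj : ∀ u w, u < w → (u.val + w.val) % 2 = 1 → JoinedIn (F u w) (x u) (x w))
    (hd : ∀ u w u' w', u < w → (u.val + w.val) % 2 = 1 → u' < w' → (u'.val + w'.val) % 2 = 1 →
      u ≠ u' → u ≠ w' → w ≠ u' → w ≠ w' → Disjoint (F u w) (F u' w')) : False := by
  have hi := Complex.equivRealProdCLM.symm.injective
  refine not_K33_joinedIn (fun i => Complex.equivRealProdCLM.symm (x i)) (hi.comp hx)
    (fun u w => Complex.equivRealProdCLM.symm '' F u w) (fun u w h h' => ?_)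
    (fun u w u' w' h1 h2 h3 h4 h5 h6 h7 h8 => ?_)
  · exact (hj u w h h').map Complex.equivRealProdCLM.symm.continuous
  · exact (disjoint_image_iff hi).2 (hd u w u' w' h1 h2 h3 h4 h5 h6 h7 h8)

namespace Strand

variable {m L s : ℕ}

/-- A strand is free if it does not cross the strands not sharing its ends. -/
def Free (Γ : Drawing (graph m L s)) (c : Strand m L s) : Prop :=
  ∀ c' : Strand m L s, c.lo ≠ c'.lo → NotCrossing Γ c c'

theorem exists_free_rim (hm : 1 ≤ m) (Γ : Drawing (graph m L s)) (h : Γ.crossings ≤ L)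
    (i : Fin (2 * m + 2)) : ∃ j, Free Γ (rim i j) := by
  obtain ⟨j, hj⟩ := exists_notCrossing hm Γ (fun j : Fin (L + 1) => rim i j)
    (fun j j' h => by simpa using h) (by simpa using Nat.lt_succ_of_le h)
  refine ⟨j, fun c' hc' => hj c' fun j' hj' => hc' ?_⟩
  rw [hj']
  rfl

theorem exists_free_long (hm : 1 ≤ m) (Γ : Drawing (graph m L s)) (h : Γ.crossings < s) :
    ∃ t, Free Γ (long t) := by
  obtain ⟨t, ht⟩ := exists_notCrossing hm Γ (fun t : Fin s => long t)
    (fun j j' h => by simpa using h) (by simpa using h)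
  refine ⟨t, fun c' hc' => ht c' fun j' hj' => hc' ?_⟩
  rw [hj']
  rfl

theorem NotCrossing.symm {Γ : Drawing (graph m L s)} {c c' : Strand m L s}
    (h : NotCrossing Γ c c') : NotCrossing Γ c' c :=
  fun e he f hf p hp => h f hf e he p hp.symm

section

variable (J : Fin (2 * m + 2) → Fin (L + 1)) (t : Fin s) (a b : Fin m)

/-- The strands making up the edges of a subdivision of `K₃,₃`. -/
def branch (u w : ℕ) (c : Strand m L s) : Prop :=
  (∃ i, c = rim i (J i) ∧
    (u = 0 ∧ w = 1 ∧ i.val < a + 1 ∨ u = 1 ∧ w = 2 ∧ a + 1 ≤ i.val ∧ i.val < b + 1 ∨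
      u = 2 ∧ w = 3 ∧ b + 1 ≤ i.val ∧ i.val < m + 1 ∨
      u = 3 ∧ w = 4 ∧ m + 1 ≤ i.val ∧ i.val < a + m + 2 ∨
      u = 4 ∧ w = 5 ∧ a + m + 2 ≤ i.val ∧ i.val < b + m + 2 ∨
      u = 0 ∧ w = 5 ∧ b + m + 2 ≤ i.val)) ∨
  (u = 0 ∧ w = 3 ∧ c = long t) ∨ (u = 1 ∧ w = 4 ∧ c = chord a) ∨ (u = 2 ∧ w = 5 ∧ c = chord b)

theorem branch_ends {u w : ℕ} {c : Strand m L s} (hab : a < b) (h : branch J t a b u w c) :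
    (u = 0 ∧ w = 1 ∧ c.lo.val < a + 1 ∧ c.hi.val = c.lo + 1 ∨
      u = 1 ∧ w = 2 ∧ a + 1 ≤ c.lo.val ∧ c.lo.val < b + 1 ∧ c.hi.val = c.lo + 1 ∨
      u = 2 ∧ w = 3 ∧ b + 1 ≤ c.lo.val ∧ c.lo.val < m + 1 ∧ c.hi.val = c.lo + 1 ∨
      u = 3 ∧ w = 4 ∧ m + 1 ≤ c.lo.val ∧ c.lo.val < a + m + 2 ∧ c.hi.val = c.lo + 1 ∨
      u = 4 ∧ w = 5 ∧ a + m + 2 ≤ c.lo.val ∧ c.lo.val < b + m + 2 ∧ c.hi.val = c.lo + 1) ∨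
    (u = 0 ∧ w = 5 ∧ (b + m + 2 ≤ c.lo.val ∧ c.hi.val = c.lo + 1 ∨
      c.lo.val = 0 ∧ c.hi.val = 2 * m + 1)) ∨
    (u = 0 ∧ w = 3 ∧ c.lo.val = 0 ∧ c.hi.val = m + 1) ∨
    (u = 1 ∧ w = 4 ∧ c.lo.val = a + 1 ∧ c.hi.val = a + m + 2) ∨
    (u = 2 ∧ w = 5 ∧ c.lo.val = b + 1 ∧ c.hi.val = b + m + 2) := by
  have ha := a.2
  have hb := b.2
  rcases h with ⟨i, rfl, h⟩ | ⟨rfl, rfl, rfl⟩ | ⟨rfl, rfl, rfl⟩ | ⟨rfl, rfl, rfl⟩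
  · have hi' : (rim i (J i) : Strand m L s).hi.val = min (i.val + 1) (2 * m + 1) := rfl
    have := i.2
    have hlo := lo_rim (s := s) i (J i)
    by_cases hl : i.val = 2 * m + 1
    · rw [if_pos hl] at hlo
      refine Or.inr (Or.inl ⟨by omega, by omega, Or.inr ⟨hlo, by omega⟩⟩)
    · rw [if_neg hl] at hlo
      have hhi : (rim i (J i) : Strand m L s).hi.val = i.val + 1 := by omega
      rw [hlo, hhi]
      rcases h with h | h | h | h | h | h
      · exact Or.inl (Or.inl (by omega))
      · exact Or.inl (Or.inr (Or.inl (by omega)))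
      · exact Or.inl (Or.inr (Or.inr (Or.inl (by omega))))
      · exact Or.inl (Or.inr (Or.inr (Or.inr (Or.inl (by omega)))))
      · exact Or.inl (Or.inr (Or.inr (Or.inr (Or.inr (by omega)))))
      · exact Or.inr (Or.inl ⟨h.1, h.2.1, Or.inl ⟨h.2.2, rfl⟩⟩)
  · simp [lo, hi]
  · simp [lo, hi]
  · simp [lo, hi]

theorem branch_disjoint {u w u' w' : ℕ} {c c' : Strand m L s} (hab : a < b)
    (h : branch J t a b u w c) (h' : branch J t a b u' w' c') (h1 : u ≠ u') (h2 : u ≠ w')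
    (h3 : w ≠ u') (h4 : w ≠ w') :
    (c.lo.val ≠ c'.lo.val ∧ c.lo.val ≠ c'.hi.val) ∧
      c.hi.val ≠ c'.lo.val ∧ c.hi.val ≠ c'.hi.val := by
  have ha := a.2
  have hb := b.2
  have q := branch_ends J t a b hab h
  have q' := branch_ends J t a b hab h'
  rcases q with (q | q | q | q | q) | q | q | q | q <;>
  rcases q' with (q' | q' | q' | q' | q') | q' | q' | q' | q' <;> omega

end

theorem joinedIn_arc (Γ : Drawing (graph m L s)) (J : Fin (2 * m + 2) → Fin (L + 1))
    {F : Set (ℝ × ℝ)} {p q : ℕ} (hpq : p < q) (hq : q < 2 * m + 2)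
    (hF : ∀ i : Fin (2 * m + 2), p ≤ i.val → i.val < q →
      (rim i (J i) : Strand m L s).trace Γ ⊆ F) :
    JoinedIn F (Γ.vpos (node ⟨p, hpq.trans hq⟩)) (Γ.vpos (node ⟨q, hq⟩)) := by
  have step : ∀ (i : ℕ) (h : i + 1 < 2 * m + 2), p ≤ i → i < q →
      JoinedIn F (Γ.vpos (node ⟨i, by omega⟩)) (Γ.vpos (node ⟨i + 1, h⟩)) := by
    intro i h h1 h2
    have h3 := (joinedIn_trace Γ (rim ⟨i, by omega⟩ (J ⟨i, by omega⟩))).mono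
      (hF ⟨i, by omega⟩ h1 h2)
    have h4 : (rim ⟨i, by omega⟩ (J ⟨i, by omega⟩) : Strand m L s).lo = ⟨i, by omega⟩ := by
      simp only [lo]
      exact if_neg (by omega)
    have h5 : (rim ⟨i, by omega⟩ (J ⟨i, by omega⟩) : Strand m L s).hi = ⟨i + 1, h⟩ := by
      simp only [hi, Fin.mk.injEq]
      omega
    rwa [h4, h5] at h3
  obtain ⟨d, rfl⟩ := Nat.exists_eq_add_of_lt hpq
  have : ∀ e ≤ d, ∀ h : p + e + 1 < 2 * m + 2,
      JoinedIn F (Γ.vpos (node ⟨p, by omega⟩)) (Γ.vpos (node ⟨p + e + 1, h⟩)) := by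
    intro e
    induction e with
    | zero => exact fun _ h => step p h le_rfl hpq
    | succ e ih =>
      exact fun he h => (ih (by omega) (by omega)).trans (step (p + e + 1) h (by omega) (by omega))
  exact this d le_rfl hq

theorem not_notCrossing_chord (hm : 1 ≤ m) (Γ : Drawing (graph m L s)) (h : Γ.crossings ≤ L)
    (h' : L < s) {a b : Fin m} (hab : a < b) :
    ¬ NotCrossing Γ (chord a : Strand m L s) (chord b) := by
  intro hnc
  choose J hJ using exists_free_rim hm Γ h
  obtain ⟨t, ht⟩ := exists_free_long hm Γ (h.trans_lt h')
  have hab' : a.val < b.val := hab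
  have ha := a.2
  have hb := b.2
  let N : Fin 6 → Fin (2 * m + 2) := ![⟨0, by omega⟩, ⟨a + 1, by omega⟩, ⟨b + 1, by omega⟩,
    ⟨m + 1, by omega⟩, ⟨a + m + 2, by omega⟩, ⟨b + m + 2, by omega⟩]
  have hN : StrictMono N := by
    rw [Fin.strictMono_iff_lt_succ]
    intro i
    fin_cases i <;> simp only [N, Fin.lt_def] <;> simp <;> omega
  let F : Fin 6 → Fin 6 → Set (ℝ × ℝ) := fun u w =>
    ⋃ c ∈ {c : Strand m L s | branch J t a b u w c}, c.trace Γ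
  have hF : ∀ {u w : Fin 6} {c : Strand m L s}, branch J t a b u w c → c.trace Γ ⊆ F u w :=
    fun hc => subset_biUnion_of_mem (u := fun c : Strand m L s => c.trace Γ) hc
  have h01 : JoinedIn (F 0 1) (Γ.vpos (node (N 0))) (Γ.vpos (node (N 1))) :=
    joinedIn_arc Γ J (by omega) (by omega) fun i h1 h2 => hF (Or.inl ⟨i, rfl, by simp; omega⟩)
  have h12 : JoinedIn (F 1 2) (Γ.vpos (node (N 1))) (Γ.vpos (node (N 2))) :=
    joinedIn_arc Γ J (by omega) (by omega) fun i h1 h2 => hF (Or.inl ⟨i, rfl, by simp; omega⟩)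
  have h23 : JoinedIn (F 2 3) (Γ.vpos (node (N 2))) (Γ.vpos (node (N 3))) :=
    joinedIn_arc Γ J (by omega) (by omega) fun i h1 h2 => hF (Or.inl ⟨i, rfl, by simp; omega⟩)
  have h34 : JoinedIn (F 3 4) (Γ.vpos (node (N 3))) (Γ.vpos (node (N 4))) :=
    joinedIn_arc Γ J (by omega) (by omega) fun i h1 h2 => hF (Or.inl ⟨i, rfl, by simp; omega⟩)
  have h45 : JoinedIn (F 4 5) (Γ.vpos (node (N 4))) (Γ.vpos (node (N 5))) :=
    joinedIn_arc Γ J (by omega) (by omega) fun i h1 h2 => hF (Or.inl ⟨i, rfl, by simp; omega⟩)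
  have h03 : JoinedIn (F 0 3) (Γ.vpos (node (N 0))) (Γ.vpos (node (N 3))) :=
    (joinedIn_trace Γ (long t)).mono (hF (Or.inr (Or.inl ⟨rfl, rfl, rfl⟩)))
  have h14 : JoinedIn (F 1 4) (Γ.vpos (node (N 1))) (Γ.vpos (node (N 4))) :=
    (joinedIn_trace Γ (chord a)).mono (hF (Or.inr (Or.inr (Or.inl ⟨rfl, rfl, rfl⟩))))
  have h25 : JoinedIn (F 2 5) (Γ.vpos (node (N 2))) (Γ.vpos (node (N 5))) :=
    (joinedIn_trace Γ (chord b)).mono (hF (Or.inr (Or.inr (Or.inr ⟨rfl, rfl, rfl⟩))))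
  have h05 : JoinedIn (F 0 5) (Γ.vpos (node (N 0))) (Γ.vpos (node (N 5))) := by
    have hF' : ∀ i : Fin (2 * m + 2), b + m + 2 ≤ i.val →
        (rim i (J i) : Strand m L s).trace Γ ⊆ F 0 5 :=
      fun i hi' => hF (Or.inl ⟨i, rfl, by simp; omega⟩)
    let l : Fin (2 * m + 2) := ⟨2 * m + 1, by omega⟩
    have h1 := (joinedIn_trace Γ (rim l (J l))).mono (hF' l (by simp only [l]; omega))
    have h2 : (rim l (J l) : Strand m L s).lo = N 0 := by simp [lo, l, N]
    have h3 : (rim l (J l) : Strand m L s).hi = l := by simp [hi, l]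
    rw [h2, h3] at h1
    rcases eq_or_lt_of_le (show b.val + m + 2 ≤ 2 * m + 1 by omega) with h4 | h4
    · have h5 : l = N 5 := Fin.ext h4.symm
      rwa [h5] at h1
    · exact h1.trans (joinedIn_arc Γ J h4 (by omega) fun i h1 _ => hF' i h1).symm
  refine not_K33_joinedIn_prod (fun i => Γ.vpos (node (N i)))
    (Γ.vpos_inj.comp (node_injective.comp hN.injective)) F (fun u w huw hodd => ?_)
    (fun u w u' w' huw hodd huw' hodd' h1 h2 h3 h4 => ?_)
  · fin_cases u <;> fin_cases w <;>
      first
      | exact h01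
      | exact h03
      | exact h05
      | exact h12
      | exact h14
      | exact h23
      | exact h25
      | exact h34
      | exact h45
      | exact absurd huw (by decide)
      | exact absurd hodd (by decide)
  · simp only [F, disjoint_iUnion_left, disjoint_iUnion_right]
    intro c' hc' c hc
    have hv : ∀ {i j : Fin 6}, i ≠ j → i.val ≠ j.val := fun h h' => h (Fin.ext h')
    obtain ⟨⟨d1, d2⟩, d3, d4⟩ :=
      branch_disjoint J t a b hab hc hc' (hv h1) (hv h2) (hv h3) (hv h4)
    have hfree : ∀ {u w : ℕ} {c : Strand m L s}, branch J t a b u w c →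
        Free Γ c ∨ (u = 1 ∧ c = chord a) ∨ (u = 2 ∧ c = chord b) := by
      rintro u w c (⟨i, rfl, -⟩ | ⟨-, -, rfl⟩ | ⟨hu, -, rfl⟩ | ⟨hu, -, rfl⟩)
      · exact Or.inl (hJ i)
      · exact Or.inl ht
      · exact Or.inr (Or.inl ⟨hu, rfl⟩)
      · exact Or.inr (Or.inr ⟨hu, rfl⟩)
    have hlo : c.lo ≠ c'.lo := fun h => d1 (congrArg Fin.val h)
    have hnot : NotCrossing Γ c c' := by
      rcases hfree hc with h | ⟨hu, rfl⟩ | ⟨hu, rfl⟩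
      · exact h c' hlo
      · rcases hfree hc' with h | ⟨hu', rfl⟩ | ⟨hu', rfl⟩
        · exact (h _ hlo.symm).symm
        · exact absurd rfl hlo
        · exact hnc
      · rcases hfree hc' with h | ⟨hu', rfl⟩ | ⟨hu', rfl⟩
        · exact (h _ hlo.symm).symm
        · exact hnc.symm
        · exact absurd rfl hlo
    exact disjoint_trace hnot hlo (fun h => d2 (congrArg Fin.val h))
      (fun h => d3 (congrArg Fin.val h)) (fun h => d4 (congrArg Fin.val h))

theorem exists_chord_edge (a : Fin m) :
    ∃ e : Sym2 (Vtx m L s), ∀ f ∈ (chord a : Strand m L s).edges, ¬ f.IsDiag → f = e := by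
  refine ⟨s((chord a : Strand m L s).mid, node (chord a : Strand m L s).hi), ?_⟩
  rintro f (rfl | rfl) hf
  · exact absurd rfl hf
  · rfl

/-- If every chord crosses every other one, many crossings are to be assigned to the chords. -/
theorem sum_range_le_of_isKGapPlanar (hm : 1 ≤ m) {k : ℕ} (Γ : Drawing (graph m L s))
    (hΓ : Γ.IsKGapPlanar k) (h : Γ.crossings ≤ L) (h' : L < s) :
    ∑ i ∈ Finset.range m, i ≤ k * m := by
  classical
  obtain ⟨assign, ha, hk⟩ := hΓ
  choose ce hce using fun a : Fin m => exists_chord_edge (L := L) (s := s) a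
  have hcross : ∀ q : Σ b : Fin m, Fin b, ∃ p,
      Γ.Crossing (ce (q.2.castLE q.1.2.le)) (ce q.1) p := by
    rintro ⟨b, a⟩
    have := not_notCrossing_chord hm Γ h h' (a := a.castLE b.2.le) (b := b) a.2
    simp only [NotCrossing, not_forall, not_not] at this
    obtain ⟨e, he, f, hf, p, hp⟩ := this
    rw [hce _ e he ((graph m L s).not_isDiag_of_mem_edgeSet hp.1),
      hce _ f hf ((graph m L s).not_isDiag_of_mem_edgeSet hp.2.1)] at hp
    exact ⟨p, hp⟩
  choose P hP using hcross
  have hce_inj : ∀ a b : Fin m, a < b → ce a ≠ ce b := fun a b hab =>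
    (hP ⟨b, ⟨a, hab⟩⟩).2.2.1
  have hce_inj' : Function.Injective ce := by
    intro a b hab
    rcases lt_trichotomy a b with h | h | h
    · exact absurd hab (hce_inj _ _ h)
    · exact h
    · exact absurd hab.symm (hce_inj _ _ h)
  have hPinj : Function.Injective P := by
    rintro ⟨b, a⟩ ⟨b', a'⟩ e
    have h1 := hP ⟨b, a⟩
    have h2 := hP ⟨b', a'⟩
    rw [← e] at h2
    have e1 := (h1.eq_or_eq h2.1 h2.2.2.2.1).imp (@hce_inj' _ _) (@hce_inj' _ _)
    have e2 := (h1.eq_or_eq h2.2.1 h2.2.2.2.2.1).imp (@hce_inj' _ _) (@hce_inj' _ _)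
    simp only [Fin.ext_iff, Fin.val_castLE] at e1 e2
    have l1 := a.2
    have l2 := a'.2
    have hb : b = b' := Fin.ext (by omega)
    subst hb
    have : a = a' := Fin.ext (by omega)
    rw [this]
  have hmem : ∀ q, P q ∈ Γ.crossingSet := fun q => ⟨_, _, hP q⟩
  have hassign : ∀ q, ∃ a, assign (P q) = ce a := by
    intro q
    obtain ⟨f, hf⟩ := ha (P q) (hmem q)
    rcases (hP q).eq_or_eq hf.1 hf.2.2.2.1 with h | h
    · exact ⟨_, h⟩
    · exact ⟨_, h⟩
  choose A hA using hassign
  have hfib : ∀ a ∈ Finset.univ.image A, (Finset.univ.filter fun q => A q = a).card ≤ k := by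
    intro a _
    rw [← Finset.card_image_of_injective _ hPinj, ← ncard_coe_finset]
    refine (ncard_le_ncard ?_ (Γ.finite_crossingSet.subset fun p hp => hp.1)).trans (hk (ce a))
    intro p hp
    simp only [Finset.coe_image, Finset.coe_filter, Finset.mem_univ, true_and] at hp
    obtain ⟨q, rfl, rfl⟩ := hp
    exact ⟨hmem q, hA q⟩
  have hle := Finset.card_le_mul_card_image Finset.univ k hfib
  rw [Finset.card_univ, Fintype.card_sigma] at hle
  simp only [Fintype.card_fin] at hle
  rw [Fin.sum_univ_eq_sum_range (fun i => i)] at hle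
  refine hle.trans (Nat.mul_le_mul_left _ ?_)
  exact (Finset.card_le_univ _).trans (by simp)

theorem lt_crossings {k : ℕ} (Γ : Drawing (graph (2 * k + 2) L s)) (hΓ : Γ.IsKGapPlanar k)
    (h : L < s) : L < Γ.crossings := by
  by_contra! hle
  have h1 := sum_range_le_of_isKGapPlanar (by omega) Γ hΓ hle h
  have h2 := Finset.sum_range_id_mul_two (2 * k + 2)
  rw [show 2 * k + 2 - 1 = 2 * k + 1 by omega] at h2
  nlinarith

end Strand

namespace Drawing

variable {V W : Type} {G : SimpleGraph V} {H : SimpleGraph W}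

/-- A drawing of a graph as a drawing of an isomorphic graph. -/
def congr (Γ : Drawing G) (φ : H ≃g G) : Drawing H where
  vpos w := Γ.vpos (φ w)
  vpos_inj := Γ.vpos_inj.comp φ.injective
  arc u v := Γ.arc (φ u) (φ v)
  arc_symm _ _ := Γ.arc_symm _ _
  arc_cont _ _ h := Γ.arc_cont _ _ (φ.map_adj_iff.2 h)
  arc_injOn _ _ h := Γ.arc_injOn _ _ (φ.map_adj_iff.2 h)
  arc_start _ _ h := Γ.arc_start _ _ (φ.map_adj_iff.2 h)
  arc_end _ _ h := Γ.arc_end _ _ (φ.map_adj_iff.2 h)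
  arc_avoids u v h t ht := fun ⟨w, hw⟩ =>
    Γ.arc_avoids _ _ (φ.map_adj_iff.2 h) t ht ⟨φ w, hw⟩
  inter_finite u v w z h h' hne := Γ.inter_finite _ _ _ _ (φ.map_adj_iff.2 h)
    (φ.map_adj_iff.2 h') fun e => hne (Sym2.map.injective φ.injective e)
  no_triple_point p hp u₁ v₁ u₂ v₂ u₃ v₃ h₁ h₂ h₃ h12 h13 h23 :=
    Γ.no_triple_point p (fun ⟨v, hv⟩ => hp ⟨φ.symm v, by simpa using hv⟩) _ _ _ _ _ _
      (φ.map_adj_iff.2 h₁) (φ.map_adj_iff.2 h₂) (φ.map_adj_iff.2 h₃)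
      (fun e => h12 (Sym2.map.injective φ.injective e))
      (fun e => h13 (Sym2.map.injective φ.injective e))
      (fun e => h23 (Sym2.map.injective φ.injective e))

theorem crossing_congr (Γ : Drawing G) (φ : H ≃g G) {e f : Sym2 W} {p : ℝ × ℝ} :
    (Γ.congr φ).Crossing e f p ↔ Γ.Crossing (e.map φ) (f.map φ) p := by
  induction e with | _ u v
  induction f with | _ w z
  have hr : range (Γ.congr φ).vpos = range Γ.vpos := φ.surjective.range_comp Γ.vpos
  unfold Crossing
  rw [hr, (Sym2.map.injective φ.injective).ne_iff]
  simp only [Sym2.map_mk, SimpleGraph.mem_edgeSet, φ.map_adj_iff]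
  rfl

theorem crossingSet_congr (Γ : Drawing G) (φ : H ≃g G) :
    (Γ.congr φ).crossingSet = Γ.crossingSet := by
  have hs : Function.Surjective (Sym2.map φ) := fun e => by
    induction e with | _ u v
    exact ⟨s(φ.symm u, φ.symm v), by simp⟩
  ext p
  constructor
  · rintro ⟨e, f, h⟩
    exact ⟨_, _, (Γ.crossing_congr φ).1 h⟩
  · rintro ⟨e, f, h⟩
    obtain ⟨e, rfl⟩ := hs e
    obtain ⟨f, rfl⟩ := hs f
    exact ⟨e, f, (Γ.crossing_congr φ).2 h⟩

theorem IsKGapPlanar.congr {Γ : Drawing G} {k : ℕ} (h : Γ.IsKGapPlanar k) (φ : H ≃g G) :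
    (Γ.congr φ).IsKGapPlanar k := by
  obtain ⟨assign, h1, h2⟩ := h
  have hid : ∀ e : Sym2 V, (e.map φ.symm).map φ = e := fun e => by
    induction e with | _ u v
    simp
  refine ⟨fun p => (assign p).map φ.symm, fun p hp => ?_, fun e => ?_⟩
  · rw [crossingSet_congr] at hp
    obtain ⟨f, hf⟩ := h1 p hp
    exact ⟨f.map φ.symm, (Γ.crossing_congr φ).2 (by rwa [hid, hid])⟩
  · refine le_of_eq_of_le ?_ (h2 (e.map φ))
    rw [crossingSet_congr]
    congr 1
    ext p
    refine and_congr_right fun _ => ⟨fun h => by rw [← h, hid], fun h => ?_⟩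
    exact Sym2.map.injective φ.injective (by rw [hid, h])

end Drawing

/-- For all `k ≥ 1` and `ℓ ≥ 2` there exists a `k`-gap-planar
simple graph on exactly `n = 16kℓ - 8k + 1` vertices with `cr_{k-gap}(G) ≥ ℓ`
and `cr(G) ≤ 8k² - 2k` (hence the `k`-gap-planar crossing ratio is `Ω(n/k³)`). -/
theorem k_gap_planar_crossing_ratio_lower (k ℓ : ℕ) (hk : 1 ≤ k) (hℓ : 2 ≤ ℓ) :
    ∃ G : SimpleGraph (Fin (16 * k * ℓ - 8 * k + 1)),
      (∃ Γ : Drawing G, Γ.IsKGapPlanar k) ∧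
      ℓ ≤ crNumRestricted G (fun Γ => Γ.IsKGapPlanar k) ∧
      crNum G ≤ 8 * k ^ 2 - 2 * k := by
  obtain ⟨L, rfl⟩ : ∃ L, ℓ = L + 1 := ⟨ℓ - 1, by omega⟩
  obtain ⟨s, hs⟩ : ∃ s, 16 * k * (L + 1) - 8 * k + 1 = (4 * k + 6) * (L + 1) + s :=
    Nat.exists_eq_add_of_le (by
      have : (4 * k + 6) * (L + 1) + 8 * k ≤ 16 * k * (L + 1) + 1 := by nlinarith
      omega)
  have hLs : L < s := by
    have : (4 * k + 6) * (L + 1) + 8 * k + (L + 1) ≤ 16 * k * (L + 1) + 1 := by nlinarith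
    omega
  have hcard : Fintype.card (Fin (16 * k * (L + 1) - 8 * k + 1)) =
      Fintype.card (Vtx (2 * k + 2) L s) := by
    rw [hs]
    simp
    ring
  let φ := SimpleGraph.Iso.comap (Fintype.equivOfCardEq hcard) (Strand.graph (2 * k + 2) L s)
  have hgap := (Strand.isKGapPlanar_drawing_true hk L s).congr φ
  refine ⟨_, ⟨_, hgap⟩, ?_, ?_⟩
  · refine le_csInf ⟨_, _, hgap, rfl⟩ ?_
    rintro n ⟨Γ, hΓ, rfl⟩
    have := Strand.lt_crossings _ (hΓ.congr φ.symm) hLs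
    rwa [Drawing.crossings, Drawing.crossingSet_congr] at this
  · have hle : crNum _ ≤ ((Strand.drawing (2 * k + 2) L s false).congr φ).crossings :=
      Nat.sInf_le ⟨(Strand.drawing (2 * k + 2) L s false).congr φ, rfl⟩
    refine hle.trans ?_
    rw [Drawing.crossings, Drawing.crossingSet_congr]
    refine (Strand.crossings_drawing_false_le _ _ _).trans ?_
    have h2 := Finset.sum_range_id_mul_two (2 * k + 2)
    rw [show 2 * k + 2 - 1 = 2 * k + 1 by omega] at h2
    have : (∑ i ∈ Finset.range (2 * k + 2), i) + 2 * k ≤ 8 * k ^ 2 := by nlinarith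
    omega
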